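/- Let n ≥ 3. Assume g ∈ SL(n,ℤ), (S, 𝒜, ℛ) is a Schottky system whose generated subgroup is profinitely dense, δ ≥ ε > 0, p₁ and p₂ are rational points of ℙ, and L₁ and L₂ are rational projective hyperplanes with p₁ ∈ L₁ and p₂ ∈ L₂, such that: (1) ([p₁]_ε ∪ [p₂]_ε) ∩ ℛ = ∅ and ([L₁]_δ ∪ [L₂]_δ) ∩ 𝒜 = ∅; (2) [p₁]_ε ∩ [L₂]_δ = ∅ and [p₂]_ε ∩ [L₁]_δ = ∅; (3) p₁ = g • p₂ and L₁ ≠ g • L₂. Then there exists a set S₊ ⊇ S such that (S₊, 𝒜 ∪ [p₁]_ε ∪ [p₂]_ε, ℛ ∪ [L₁]_δ ∪ [L₂]_δ) is a Schottky system containing (S, 𝒜, ℛ) and the subgroup generated by S₊ ∪ {g} is all of SL(n,ℤ). -/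

import Mathlib

/- Common setup: `SL(n,ℤ)`, `SL(n,ℝ)`, the real projective space `ℙ^{n-1}(ℝ)`
with its quotient topology and the projective action, rank-1 unipotent elements
and their attracting points / fixed hyperplanes, metrics compatible with the
topology of `ℙ`, `ε`-neighbourhoods, Schottky systems, profinite density,
maximal subgroups, and lattices in `SL(n,ℝ)`. -/

open Matrix LinearAlgebra.Projectivization

abbrev SLZ (n : ℕ) := Matrix.SpecialLinearGroup (Fin n) ℤ

abbrev SLR (n : ℕ) := Matrix.SpecialLinearGroup (Fin n) ℝ

/-- The real projective space `ℙ^{n-1}(ℝ)`: the projectivization of `ℝⁿ`. -/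
abbrev Proj (n : ℕ) := Projectivization ℝ (Fin n → ℝ)

/-- The quotient topology on `ℙ^{n-1}(ℝ)`. -/
noncomputable instance (n : ℕ) : TopologicalSpace (Proj n) :=
  inferInstanceAs (TopologicalSpace (Quotient _))

/-- The action of `SL(n,ℝ)` on `ℙ^{n-1}(ℝ)` induced by the linear action on `ℝⁿ`. -/
noncomputable def actR {n : ℕ} (g : SLR n) (x : Proj n) : Proj n :=
  Projectivization.map (Matrix.SpecialLinearGroup.toLin' g).toLinearMap
    (Matrix.SpecialLinearGroup.toLin' g).injective x

/-- The action of `SL(n,ℤ)` on `ℙ^{n-1}(ℝ)` induced by the linear action on `ℝⁿ`. -/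
noncomputable def act {n : ℕ} (g : SLZ n) (x : Proj n) : Proj n :=
  actR (Matrix.SpecialLinearGroup.map (Int.castRingHom ℝ) g) x

/-- The real matrix attached to `g ∈ SL(n,ℤ)`. -/
noncomputable def matR {n : ℕ} (g : SLZ n) : Matrix (Fin n) (Fin n) ℝ :=
  ((Matrix.SpecialLinearGroup.map (Int.castRingHom ℝ)) g : Matrix (Fin n) (Fin n) ℝ)

/-- The subspace `Im(u - I) ⊆ ℝⁿ` (a line when `u` is rank-1 unipotent). -/
noncomputable def lineOf {n : ℕ} (u : SLZ n) : Submodule ℝ (Fin n → ℝ) :=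
  LinearMap.range (Matrix.mulVecLin (matR u - 1))

/-- The subspace `ker(u - I) ⊆ ℝⁿ` (a hyperplane when `u` is rank-1 unipotent). -/
noncomputable def hypOf {n : ℕ} (u : SLZ n) : Submodule ℝ (Fin n → ℝ) :=
  LinearMap.ker (Matrix.mulVecLin (matR u - 1))

/-- The rational matrix attached to `g ∈ SL(n,ℤ)`. -/
noncomputable def matQ {n : ℕ} (g : SLZ n) : Matrix (Fin n) (Fin n) ℚ :=
  ((Matrix.SpecialLinearGroup.map (Int.castRingHom ℚ)) g : Matrix (Fin n) (Fin n) ℚ)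

/-- `g - I`, as a `ℚ`-linear endomorphism of `ℚⁿ`. -/
noncomputable def linQ {n : ℕ} (g : SLZ n) : (Fin n → ℚ) →ₗ[ℚ] (Fin n → ℚ) :=
  Matrix.mulVecLin (matQ g - 1)

/-- `u` is a rank-1 unipotent element of `SL(n,ℤ)`: `u - I` is nilpotent of rank one. -/
def IsR1U {n : ℕ} (u : SLZ n) : Prop :=
  IsNilpotent (linQ u) ∧ Module.finrank ℚ (LinearMap.range (linQ u)) = 1

/-- The point of attraction `p_u` of `u`, as a subset of `ℙ` (a singleton when `u` is a
rank-1 unipotent): the projective points whose representative spans `Im(u - I)`. -/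
def attSet {n : ℕ} (u : SLZ n) : Set (Proj n) :=
  {x | x.submodule = lineOf u}

/-- The fixed hyperplane `L_u` of `u`, as a subset of `ℙ`. -/
def fixSet {n : ℕ} (u : SLZ n) : Set (Proj n) :=
  {x | x.submodule ≤ hypOf u}

/-- The subset of `ℙ` corresponding to a linear subspace `W ⊆ ℝⁿ`. -/
def projSet {n : ℕ} (W : Submodule ℝ (Fin n → ℝ)) : Set (Proj n) :=
  {x | x.submodule ≤ W}

/-- The image `g • W` of a subspace of `ℝⁿ` under `g ∈ SL(n,ℤ)`. -/
noncomputable def actSub {n : ℕ} (g : SLZ n) (W : Submodule ℝ (Fin n → ℝ)) :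
    Submodule ℝ (Fin n → ℝ) :=
  Submodule.map (Matrix.mulVecLin (matR g)) W

/-- The image `g • W` of a subspace of `ℝⁿ` under `g ∈ SL(n,ℝ)`. -/
noncomputable def actSubR {n : ℕ} (g : SLR n) (W : Submodule ℝ (Fin n → ℝ)) :
    Submodule ℝ (Fin n → ℝ) :=
  Submodule.map (Matrix.mulVecLin (g : Matrix (Fin n) (Fin n) ℝ)) W

/-- `d` is a metric on `ℙ^{n-1}(ℝ)` inducing the quotient topology. -/
structure IsCompatMetric {n : ℕ} (d : Proj n → Proj n → ℝ) : Prop where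
  self : ∀ x, d x x = 0
  eq_of : ∀ x y, d x y = 0 → x = y
  symm : ∀ x y, d x y = d y x
  triangle : ∀ x y z, d x z ≤ d x y + d y z
  inducing : ∀ s : Set (Proj n), IsOpen s ↔ ∀ x ∈ s, ∃ ε > 0, ∀ y, d x y < ε → y ∈ s

/-- The distance from a point to a set. -/
noncomputable def setDist {n : ℕ} (d : Proj n → Proj n → ℝ) (x : Proj n)
    (A : Set (Proj n)) : ℝ :=
  sInf (d x '' A)

/-- The open `ε`-neighbourhood `(A)_ε = {x | dist(x, A) < ε}`. -/
def oThick {n : ℕ} (d : Proj n → Proj n → ℝ) (A : Set (Proj n)) (ε : ℝ) : Set (Proj n) :=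
  {x | setDist d x A < ε}

/-- The closed `ε`-neighbourhood `[A]_ε = {x | dist(x, A) ≤ ε}`. -/
def cThick {n : ℕ} (d : Proj n → Proj n → ℝ) (A : Set (Proj n)) (ε : ℝ) : Set (Proj n) :=
  {x | setDist d x A ≤ ε}

/-- The Hausdorff distance between two subsets of `ℙ`. -/
noncomputable def hDist {n : ℕ} (d : Proj n → Proj n → ℝ) (A B : Set (Proj n)) : ℝ :=
  max (sSup ((fun a => setDist d a B) '' A)) (sSup ((fun b => setDist d b A) '' B))

/-- A rational point of `ℙ`: one spanned by a vector of `ℚⁿ`. -/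
def RatPoint {n : ℕ} (p : Proj n) : Prop :=
  ∃ v : Fin n → ℚ, p.submodule = Submodule.span ℝ {fun i => ((v i : ℝ))}

/-- A subspace of `ℝⁿ` spanned by vectors of `ℚⁿ`. -/
def IsRatSubmodule {n : ℕ} (W : Submodule ℝ (Fin n → ℝ)) : Prop :=
  ∃ T : Set (Fin n → ℚ),
    W = Submodule.span ℝ ((fun (v : Fin n → ℚ) (i : Fin n) => ((v i : ℝ))) '' T)

/-- A Schottky system `(S, 𝒜, ℛ)` with respect to the metric `d`: `S` is a nonempty
set of rank-1 unipotents, `𝒜 ⊆ ℛ` are closed, and for each `u ∈ S` there are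
`δ_u ≥ ε_u > 0` satisfying the ping-pong conditions. -/
structure IsSchottky {n : ℕ} (d : Proj n → Proj n → ℝ) (S : Set (SLZ n))
    (A R : Set (Proj n)) : Prop where
  nonempty : S.Nonempty
  unip : ∀ u ∈ S, IsR1U u
  AsubR : A ⊆ R
  closedA : IsClosed A
  closedR : IsClosed R
  cond : ∃ ε δ : SLZ n → ℝ, (∀ u ∈ S, 0 < ε u ∧ ε u ≤ δ u) ∧
    (∀ u ∈ S, ∀ k : ℤ, k ≠ 0 → ∀ x, x ∉ oThick d (fixSet u) (δ u) →
      act (u ^ k) x ∈ oThick d (attSet u) (ε u)) ∧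
    (∀ u ∈ S, ∀ v ∈ S, u ≠ v → oThick d (attSet u) (ε u) ∩ oThick d (fixSet v) (δ v) = ∅) ∧
    (∀ u ∈ S, oThick d (attSet u) (ε u) ⊆ A) ∧
    (∀ u ∈ S, oThick d (fixSet u) (δ u) ⊆ R)

/-- `H` is profinitely dense in `G`: `HN = G` for every finite-index normal `N ⊴ G`. -/
def ProfinitelyDense {G : Type*} [Group G] (H : Subgroup G) : Prop :=
  ∀ N : Subgroup G, N.Normal → N.FiniteIndex → H ⊔ N = ⊤

/-- `M` is a maximal (proper) subgroup of `G`. -/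
def IsMaxSubgroup {G : Type*} [Group G] (M : Subgroup G) : Prop :=
  M ≠ ⊤ ∧ ∀ K : Subgroup G, M < K → K = ⊤

noncomputable instance (n : ℕ) : TopologicalSpace (SLR n) :=
  inferInstanceAs (TopologicalSpace {A : Matrix (Fin n) (Fin n) ℝ // A.det = 1})

noncomputable instance (n : ℕ) : MeasurableSpace (SLR n) := borel _

/-- `Γ ≤ SL(n,ℝ)` is a lattice: a discrete subgroup admitting a Borel fundamental
domain of finite Haar measure. -/
def IsLatticeIn {n : ℕ} (Γ : Subgroup (SLR n)) : Prop :=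
  DiscreteTopology Γ ∧
  ∃ μ : MeasureTheory.Measure (SLR n), μ.IsHaarMeasure ∧
    ∃ D : Set (SLR n), MeasurableSet D ∧ μ D < ⊤ ∧
      ∀ g : SLR n, ∃! γ : Γ, (γ : SLR n)⁻¹ * g ∈ D

section Generation

/-- The subgroup of `SL(n,ℤ)` generated by the elementary transvections. -/
def elemSubgroup (n : ℕ) : Subgroup (SLZ n) :=
  Subgroup.closure {u | ∃ (i j : Fin n) (hij : i ≠ j), u = SpecialLinearGroup.transvection hij 1}

lemma transvection_mem_elemSubgroup {n : ℕ} {i j : Fin n} (hij : i ≠ j) (c : ℤ) :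
    SpecialLinearGroup.transvection hij c ∈ elemSubgroup n := by
  have hadd : ∀ a b : ℤ, SpecialLinearGroup.transvection hij (a + b) =
      SpecialLinearGroup.transvection hij a * SpecialLinearGroup.transvection hij b :=
    fun a b => Subtype.ext (transvection_mul_transvection_same i j hij a b).symm
  have h1 : SpecialLinearGroup.transvection hij (1 : ℤ) ∈ elemSubgroup n :=
    Subgroup.subset_closure ⟨i, j, hij, rfl⟩
  have hneg : SpecialLinearGroup.transvection hij (-1 : ℤ) ∈ elemSubgroup n := by
    have : SpecialLinearGroup.transvection hij (-1 : ℤ) =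
        (SpecialLinearGroup.transvection hij (1 : ℤ))⁻¹ := by
      rw [eq_inv_iff_mul_eq_one, ← hadd]; simp
    rw [this]; exact inv_mem h1
  induction c using Int.induction_on with
  | zero => simp
  | succ k ih => rw [hadd]; exact mul_mem ih h1
  | pred k ih => rw [sub_eq_add_neg, hadd]; exact mul_mem ih hneg

/-- The first `k` columns of `M` are those of the identity matrix. -/
def StdCols {n : ℕ} (k : ℕ) (M : SLZ n) : Prop :=
  ∀ a j : Fin n, j.val < k → M.1 a j = if a = j then 1 else 0

lemma transvection_mul_apply {n : ℕ} {i j : Fin n} (hij : i ≠ j) (c : ℤ) (M : SLZ n)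
    (a b : Fin n) : (SpecialLinearGroup.transvection hij c * M).1 a b =
      M.1 a b + if a = i then c * M.1 j b else 0 := by
  change (Matrix.transvection i j c * M.1) a b = _
  split_ifs with h
  · subst h; rw [transvection_mul_apply_same]
  · rw [transvection_mul_apply_of_ne _ _ _ _ h, add_zero]

lemma StdCols.transvection_mul {n : ℕ} {k : ℕ} {M : SLZ n} (hM : StdCols k M) {i j : Fin n}
    (hij : i ≠ j) (hj : k ≤ j.val) (c : ℤ) :
    StdCols k (SpecialLinearGroup.transvection hij c * M) := by
  intro a b hb
  have hjb : j ≠ b := by rintro rfl; omega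
  rw [transvection_mul_apply, hM a b hb, hM j b hb, if_neg hjb]
  simp

lemma exists_stdCols_succ_of_diag_eq_one {n : ℕ} (k : Fin n) (M : SLZ n) (hM : StdCols k.val M)
    (h1 : M.1 k k = 1) : ∃ h ∈ elemSubgroup n, StdCols (k.val + 1) (h * M) := by
  have key : ∀ s : Finset (Fin n), ∃ h ∈ elemSubgroup n, StdCols k.val (h * M) ∧
      (h * M).1 k k = 1 ∧ ∀ a ∈ s, a ≠ k → (h * M).1 a k = 0 := by
    intro s
    induction s using Finset.induction_on with
    | empty => exact ⟨1, one_mem _, by simpa using hM, by simpa using h1, by simp⟩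
    | insert a s _ ih =>
      obtain ⟨h, hh, hstd, hk, hs⟩ := ih
      by_cases hak : a = k
      · refine ⟨h, hh, hstd, hk, fun b hb hbk => ?_⟩
        rcases Finset.mem_insert.1 hb with rfl | hb
        · exact absurd hak hbk
        · exact hs b hb hbk
      · refine ⟨SpecialLinearGroup.transvection hak (-(h * M).1 a k) * h,
          mul_mem (transvection_mem_elemSubgroup _ _) hh, ?_, ?_, ?_⟩
        · rw [mul_assoc]; exact hstd.transvection_mul hak le_rfl _
        · rw [mul_assoc, transvection_mul_apply, if_neg (Ne.symm hak), hk, add_zero]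
        · intro b hb hbk
          rw [mul_assoc, transvection_mul_apply]
          split_ifs with hba
          · subst hba; rw [hk]; ring
          · rw [add_zero]
            exact hs b ((Finset.mem_insert.1 hb).resolve_left hba) hbk
  obtain ⟨h, hh, hstd, hk, hs⟩ := key Finset.univ
  refine ⟨h, hh, fun a j hj => ?_⟩
  rcases Nat.lt_succ_iff_lt_or_eq.1 hj with hj | hj
  · exact hstd a j hj
  · obtain rfl : j = k := Fin.ext hj
    split_ifs with haj
    · subst haj; exact hk
    · exact hs a (Finset.mem_univ _) haj

lemma exists_stdCols_succ_of_forall_eq_zero {n : ℕ} (k : Fin n) (M : SLZ n)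
    (hM : StdCols k.val M) (i : Fin n) (hki : k.val ≤ i.val)
    (hi : ∀ j : Fin n, k.val ≤ j.val → j ≠ i → M.1 j k = 0) :
    ∃ h ∈ elemSubgroup n, StdCols (k.val + 1) (h * M) := by
  have hmul : (M⁻¹).1 * M.1 = 1 := congrArg Subtype.val (inv_mul_cancel M)
  have hunit : M.1 i k * M.1 i k = 1 := by
    have hinv : ∀ j : Fin n, j.val < k.val → (M⁻¹).1 k j = 0 := by
      intro j hj
      have h := congrFun (congrFun hmul k) j
      rw [Matrix.mul_apply, Finset.sum_congr rfl (fun a _ => by rw [hM a j hj])] at h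
      have hkj : k ≠ j := by rintro rfl; omega
      simpa [Matrix.one_apply, hkj] using h
    have h := congrFun (congrFun hmul k) k
    rw [Matrix.mul_apply, Matrix.one_apply_eq, Finset.sum_eq_single i] at h
    · have hu : IsUnit (M.1 i k) := IsUnit.of_mul_eq_one _ (by rw [mul_comm]; exact h)
      exact Int.isUnit_mul_self hu
    · intro b _ hb
      by_cases hbk : b.val < k.val
      · rw [hinv b hbk, zero_mul]
      · rw [hi b (not_lt.1 hbk) hb, mul_zero]
    · simp
  have reduce : ∀ e ∈ elemSubgroup n, StdCols k.val (e * M) → (e * M).1 k k = 1 →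
      ∃ h ∈ elemSubgroup n, StdCols (k.val + 1) (h * M) := by
    intro e he hs h1
    obtain ⟨h, hh, hstd⟩ := exists_stdCols_succ_of_diag_eq_one k (e * M) hs h1
    exact ⟨h * e, mul_mem hh he, by rwa [mul_assoc]⟩
  by_cases hik : i = k
  · subst hik
    rcases mul_self_eq_one_iff.1 hunit with h1 | h1
    · exact exists_stdCols_succ_of_diag_eq_one i M hM h1
    · by_cases hlast : ∃ j : Fin n, i.val < j.val
      · obtain ⟨j, hj⟩ := hlast
        have hji : j ≠ i := by rintro rfl; omega
        refine reduce (SpecialLinearGroup.transvection hji.symm 2 *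
          SpecialLinearGroup.transvection hji (-1)) (mul_mem (transvection_mem_elemSubgroup _ _)
            (transvection_mem_elemSubgroup _ _)) ?_ ?_
        · rw [mul_assoc]
          exact (hM.transvection_mul hji le_rfl _).transvection_mul _ hj.le _
        · rw [mul_assoc, transvection_mul_apply, transvection_mul_apply, transvection_mul_apply,
            if_neg hji.symm, if_pos rfl, if_pos rfl, hi j hj.le hji, h1]
          norm_num
      · exfalso
        push Not at hlast
        have htri : M.1.BlockTriangular id := by
          intro a b hab
          have hb : b.val < i.val := lt_of_lt_of_le hab (hlast a)
          have hab' : a ≠ b := by rintro rfl; exact lt_irrefl _ hab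
          rw [hM a b hb, if_neg hab']
        have hdet := M.2
        rw [Matrix.det_of_isUpperTriangular htri, Finset.prod_eq_single i] at hdet
        · rw [h1] at hdet; norm_num at hdet
        · intro b _ hb
          have : b.val < i.val := lt_of_le_of_ne (hlast b) (fun h => hb (Fin.ext h))
          rw [hM b b this, if_pos rfl]
        · simp
  · refine reduce (SpecialLinearGroup.transvection (Ne.symm hik) (M.1 i k))
      (transvection_mem_elemSubgroup _ _) (hM.transvection_mul _ hki _) ?_
    rw [transvection_mul_apply, if_pos rfl, hi k le_rfl (Ne.symm hik), hunit, zero_add]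

lemma exists_stdCols_succ {n : ℕ} (k : Fin n) (m : ℕ) : ∀ M : SLZ n, StdCols k.val M →
    ∑ i ∈ Finset.univ.filter (fun i : Fin n => k.val ≤ i.val), (M.1 i k).natAbs = m →
    ∃ h ∈ elemSubgroup n, StdCols (k.val + 1) (h * M) := by
  induction m using Nat.strong_induction_on with
  | _ m ih =>
  intro M hM hm
  by_cases hex : ∃ i j : Fin n, k.val ≤ i.val ∧ k.val ≤ j.val ∧ i ≠ j ∧ M.1 j k ≠ 0 ∧
      (M.1 j k).natAbs ≤ (M.1 i k).natAbs
  · obtain ⟨i, j, hi, hj, hij, hj0, hle⟩ := hex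
    obtain ⟨c, hc⟩ : ∃ c : ℤ, (M.1 i k + c * M.1 j k).natAbs < (M.1 i k).natAbs := by
      by_cases hs : 0 < M.1 i k ↔ 0 < M.1 j k
      · exact ⟨-1, by omega⟩
      · exact ⟨1, by omega⟩
    obtain ⟨h, hh, hstd⟩ := ih _ (by
      rw [← hm]
      refine Finset.sum_lt_sum (f := fun a =>
        ((SpecialLinearGroup.transvection hij c * M).1 a k).natAbs) ?_ ⟨i, by simpa using hi, ?_⟩
      · intro a _
        rw [transvection_mul_apply]
        split_ifs with hai
        · subst hai; exact hc.le
        · simp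
      · rw [transvection_mul_apply, if_pos rfl]; exact hc) _ (hM.transvection_mul hij hj c) rfl
    exact ⟨h * SpecialLinearGroup.transvection hij c,
      mul_mem hh (transvection_mem_elemSubgroup _ _), by rwa [mul_assoc]⟩
  · push Not at hex
    by_cases hz : ∃ i : Fin n, k.val ≤ i.val ∧ M.1 i k ≠ 0
    · obtain ⟨i, hi, hi0⟩ := hz
      refine exists_stdCols_succ_of_forall_eq_zero k M hM i hi fun j hj hji => ?_
      by_contra hj0
      have h1 := hex i j hi hj hji.symm hj0
      have h2 := hex j i hj hi hji hi0
      omega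
    · push Not at hz
      exact exists_stdCols_succ_of_forall_eq_zero k M hM k le_rfl fun j hj _ => hz j hj

/-- `SL(n,ℤ)` is generated by the elementary transvections. -/
theorem elemSubgroup_eq_top (n : ℕ) : elemSubgroup n = ⊤ := by
  rw [eq_top_iff]
  intro M _
  have key : ∀ k : ℕ, k ≤ n → ∃ h ∈ elemSubgroup n, StdCols k (h * M) := by
    intro k
    induction k with
    | zero => exact fun _ => ⟨1, one_mem _, fun a j hj => absurd hj (Nat.not_lt_zero _)⟩
    | succ k ih =>
      intro hk
      obtain ⟨h, hh, hstd⟩ := ih (by omega)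
      obtain ⟨h', hh', hstd'⟩ := exists_stdCols_succ ⟨k, hk⟩ _ (h * M) hstd rfl
      exact ⟨h' * h, mul_mem hh' hh, by rwa [mul_assoc]⟩
  obtain ⟨h, hh, hstd⟩ := key n le_rfl
  have : h * M = 1 := by
    ext a b
    rw [hstd a b b.2]; simp [Matrix.one_apply]
  rw [eq_inv_of_mul_eq_one_right this]
  exact inv_mem hh

end Generation

section Transvections

/-- The image of `SL(n,ℤ)` in the matrices over a commutative ring. -/
def castMat {n : ℕ} (R : Type*) [CommRing R] : SLZ n →* Matrix (Fin n) (Fin n) R where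
  toFun h := h.1.map (Int.castRingHom R)
  map_one' := by
    change (1 : Matrix (Fin n) (Fin n) ℤ).map (Int.castRingHom R) = 1
    exact Matrix.map_one _ (map_zero _) (map_one _)
  map_mul' a b := by
    change (a.1 * b.1).map (Int.castRingHom R) = _
    exact Matrix.map_mul

lemma matQ_eq_castMat {n : ℕ} (h : SLZ n) : matQ h = castMat ℚ h := rfl

lemma matR_eq_castMat {n : ℕ} (h : SLZ n) : matR h = castMat ℝ h := rfl

lemma castMat_int {n : ℕ} (h : SLZ n) : castMat ℤ h = h.1 := by
  ext i j; simp [castMat]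

lemma castMat_mul_inv {n : ℕ} (R : Type*) [CommRing R] (h : SLZ n) :
    castMat R h * castMat R h⁻¹ = 1 := by rw [← map_mul, mul_inv_cancel, map_one]

lemma castMat_inv_mul {n : ℕ} (R : Type*) [CommRing R] (h : SLZ n) :
    castMat R h⁻¹ * castMat R h = 1 := by rw [← map_mul, inv_mul_cancel, map_one]

/-- The coordinatewise cast of an integral vector. -/
def castVec {n : ℕ} (R : Type*) [CommRing R] (v : Fin n → ℤ) : Fin n → R := fun i => (v i : R)

lemma castVec_dot {n : ℕ} {R : Type*} [CommRing R] (v w : Fin n → ℤ) :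
    castVec R v ⬝ᵥ castVec R w = ((v ⬝ᵥ w : ℤ) : R) := by
  simp [castVec, dotProduct]

lemma castMat_mulVec {n : ℕ} {R : Type*} [CommRing R] (h : SLZ n) (v : Fin n → ℤ) :
    castMat R h *ᵥ castVec R v = castVec R (h.1 *ᵥ v) := by
  ext i; simp [castMat, castVec, mulVec, dotProduct]

lemma castVec_vecMul {n : ℕ} {R : Type*} [CommRing R] (h : SLZ n) (v : Fin n → ℤ) :
    castVec R v ᵥ* castMat R h = castVec R (v ᵥ* h.1) := by
  ext i; simp [castMat, castVec, vecMul, dotProduct]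

lemma castVec_injective {n : ℕ} (R : Type*) [CommRing R] [CharZero R] :
    Function.Injective (castVec (n := n) R) := fun v w h => by
  ext i; exact Int.cast_injective (α := R) (congrFun h i)

lemma castVec_ne_zero {n : ℕ} {R : Type*} [CommRing R] [CharZero R] {v : Fin n → ℤ}
    (hv : v ≠ 0) : castVec R v ≠ 0 := fun h => hv (castVec_injective R (by
  rw [h]; ext i; simp [castVec]))

lemma castVec_smul {n : ℕ} {R : Type*} [CommRing R] (c : ℤ) (v : Fin n → ℤ) :
    castVec R (c • v) = (c : R) • castVec R v := by
  ext i; simp [castVec]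

lemma castMat_vecMulVec {n : ℕ} {R : Type*} [CommRing R] {u : SLZ n} {x φ : Fin n → ℤ}
    (h : u.1 = 1 + vecMulVec x φ) :
    castMat R u = 1 + vecMulVec (castVec R x) (castVec R φ) := by
  ext i j
  change ((u.1 i j : ℤ) : R) = _
  rw [h]
  by_cases hij : i = j <;> simp [vecMulVec_apply, castVec, hij]

lemma map_zpow_of_mul_self_eq_zero {G R : Type*} [Group G] [Ring R] (f : G →* R) {h : G} {N : R}
    (hN : N * N = 0) (hf : f h = 1 + N) (k : ℤ) : f (h ^ k) = 1 + k • N := by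
  have hinv : f h⁻¹ = 1 - N := by
    have h1 : f h⁻¹ * (1 + N) = 1 := by rw [← hf, ← map_mul, inv_mul_cancel, map_one]
    calc f h⁻¹ = f h⁻¹ * ((1 + N) * (1 - N)) := by
          rw [show (1 + N) * (1 - N) = 1 - N * N by noncomm_ring, hN]; simp
      _ = 1 - N := by rw [← mul_assoc, h1, one_mul]
  induction k using Int.induction_on with
  | zero => simp
  | succ k ih =>
    rw [_root_.zpow_add_one, map_mul, ih, hf, mul_add, mul_one, add_mul, smul_mul_assoc, hN]
    simp [add_smul]; abel
  | pred k ih =>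
    rw [_root_.zpow_sub_one, map_mul, ih, hinv, mul_sub, mul_one, add_mul, smul_mul_assoc, hN]
    simp [sub_smul]; abel

lemma vecMulVec_mul_self {n : ℕ} {R : Type*} [CommRing R] {y ψ : Fin n → R} (h : ψ ⬝ᵥ y = 0) :
    vecMulVec y ψ * vecMulVec y ψ = 0 := by
  rw [vecMulVec_mul_vecMulVec, h]; simp

lemma smul_vecMulVec_mul_self {n : ℕ} {R : Type*} [CommRing R] {y ψ : Fin n → R}
    (h : ψ ⬝ᵥ y = 0) (c : R) : (c • vecMulVec y ψ) * (c • vecMulVec y ψ) = 0 := by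
  rw [smul_mul_assoc, mul_smul_comm, vecMulVec_mul_self h]; simp

lemma vecMul_inv_dot_mulVec {n : ℕ} {R : Type*} [CommRing R] (h : SLZ n) (ψ y : Fin n → R) :
    (ψ ᵥ* castMat R h⁻¹) ⬝ᵥ (castMat R h *ᵥ y) = ψ ⬝ᵥ y := by
  rw [dotProduct_mulVec, vecMul_vecMul, castMat_inv_mul, vecMul_one]

lemma castMat_conj {n : ℕ} {R : Type*} [CommRing R] {u : SLZ n} {M : R} {y ψ : Fin n → R}
    (hu : castMat R u = 1 + M • vecMulVec y ψ) (h : SLZ n) :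
    castMat R (h * u * h⁻¹) =
      1 + M • vecMulVec (castMat R h *ᵥ y) (ψ ᵥ* castMat R h⁻¹) := by
  rw [map_mul, map_mul, hu, mul_add, mul_one, add_mul, castMat_mul_inv, mul_smul_comm,
    smul_mul_assoc, mul_vecMulVec, vecMulVec_mul]

/-- `u` is the transvection `1 + x ⊗ φ`. -/
def IsTv {n : ℕ} (u : SLZ n) (x φ : Fin n → ℤ) : Prop :=
  φ ⬝ᵥ x = 0 ∧ u.1 = 1 + vecMulVec x φ

lemma exists_isTv {n : ℕ} {x φ : Fin n → ℤ} (h : φ ⬝ᵥ x = 0) : ∃ u : SLZ n, IsTv u x φ := by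
  refine ⟨⟨1 + vecMulVec x φ, ?_⟩, h, rfl⟩
  rw [vecMulVec_eq Unit, det_one_add_replicateCol_mul_replicateRow, h, add_zero]

lemma isTv_transvection {n : ℕ} {i j : Fin n} (hij : i ≠ j) :
    IsTv (SpecialLinearGroup.transvection hij 1) (Pi.single i 1) (Pi.single j 1) := by
  refine ⟨by simp [hij], ?_⟩
  change Matrix.transvection i j 1 = _
  rw [Matrix.transvection, single_eq_single_vecMulVec_single]

lemma IsTv.zpow {n : ℕ} {u : SLZ n} {x φ : Fin n → ℤ} (h : IsTv u x φ) (k : ℤ) :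
    IsTv (u ^ k) x (k • φ) := by
  refine ⟨by rw [smul_dotProduct, h.1, smul_zero], ?_⟩
  have := map_zpow_of_mul_self_eq_zero (castMat ℤ) (vecMulVec_mul_self h.1)
    (by rw [castMat_int]; exact h.2) k
  rw [castMat_int] at this
  rw [this, vecMulVec_smul]

lemma IsTv.conj {n : ℕ} {u : SLZ n} {x φ : Fin n → ℤ} (hu : IsTv u x φ) (h : SLZ n) :
    IsTv (h * u * h⁻¹) (h.1 *ᵥ x) (φ ᵥ* (h⁻¹).1) := by
  have h1 := vecMul_inv_dot_mulVec (R := ℤ) h φ x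
  have h2 := castMat_conj (R := ℤ) (u := u) (M := 1) (y := x) (ψ := φ)
    (by rw [castMat_int, one_smul]; exact hu.2) h
  simp only [castMat_int, one_smul] at h1 h2
  exact ⟨h1.trans hu.1, h2⟩

end Transvections

section Admissible

/-- Some transvection with rational direction `y` and rational covector `ψ` lies in `H`. -/
def Adm {n : ℕ} (H : Subgroup (SLZ n)) (y ψ : Fin n → ℚ) : Prop :=
  ψ ⬝ᵥ y = 0 ∧ ∃ M : ℚ, M ≠ 0 ∧ ∃ h ∈ H, castMat ℚ h = 1 + M • vecMulVec y ψ

lemma IsTv.adm {n : ℕ} {H : Subgroup (SLZ n)} {u : SLZ n} {x φ : Fin n → ℤ} (hu : IsTv u x φ)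
    (h : u ∈ H) : Adm H (castVec ℚ x) (castVec ℚ φ) :=
  ⟨by rw [castVec_dot, hu.1, Int.cast_zero], 1, one_ne_zero, u, h, by
    rw [one_smul, castMat_vecMulVec hu.2]⟩

variable {n : ℕ} {H : Subgroup (SLZ n)}

lemma adm_zero_right (y : Fin n → ℚ) : Adm H y 0 :=
  ⟨zero_dotProduct _, 1, one_ne_zero, 1, one_mem _, by simp⟩

lemma adm_zero_left (ψ : Fin n → ℚ) : Adm H 0 ψ :=
  ⟨dotProduct_zero _, 1, one_ne_zero, 1, one_mem _, by simp⟩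

lemma Adm.smul_right {y ψ : Fin n → ℚ} (h : Adm H y ψ) (c : ℚ) : Adm H y (c • ψ) := by
  by_cases hc : c = 0
  · subst hc; rw [zero_smul]; exact adm_zero_right y
  obtain ⟨h0, M, hM, z, hz, hzM⟩ := h
  refine ⟨by rw [smul_dotProduct, h0, smul_zero], M / c, div_ne_zero hM hc, z, hz, ?_⟩
  rw [hzM, vecMulVec_smul, smul_smul, div_mul_cancel₀ _ hc]

lemma Adm.smul_left {y ψ : Fin n → ℚ} (h : Adm H y ψ) (c : ℚ) : Adm H (c • y) ψ := by
  by_cases hc : c = 0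
  · subst hc; rw [zero_smul]; exact adm_zero_left ψ
  obtain ⟨h0, M, hM, z, hz, hzM⟩ := h
  refine ⟨by rw [dotProduct_smul, h0, smul_zero], M / c, div_ne_zero hM hc, z, hz, ?_⟩
  rw [hzM, smul_vecMulVec, smul_smul, div_mul_cancel₀ _ hc]

lemma castMat_zpow {u : SLZ n} {y ψ : Fin n → ℚ} {M : ℚ} (h0 : ψ ⬝ᵥ y = 0)
    (hu : castMat ℚ u = 1 + M • vecMulVec y ψ) (k : ℤ) :
    castMat ℚ (u ^ k) = 1 + ((k : ℚ) * M) • vecMulVec y ψ := by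
  rw [map_zpow_of_mul_self_eq_zero (castMat ℚ) (smul_vecMulVec_mul_self h0 M) hu k, mul_smul,
    Int.cast_smul_eq_zsmul]

lemma exists_int_mul_eq_int_mul {M M' : ℚ} (hM : M ≠ 0) (hM' : M' ≠ 0) :
    ∃ a b : ℤ, (a : ℚ) * M = (b : ℚ) * M' ∧ (a : ℚ) * M ≠ 0 := by
  have h1 : (M.den : ℚ) ≠ 0 := by exact_mod_cast M.den_ne_zero
  have h2 : (M'.num : ℚ) ≠ 0 := by exact_mod_cast Rat.num_ne_zero.2 hM'
  refine ⟨M'.num * M.den, M.num * M'.den, ?_, ?_⟩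
  · push_cast
    have e1 := Rat.mul_den_eq_num M
    have e2 := Rat.mul_den_eq_num M'
    calc (M'.num : ℚ) * M.den * M = M'.num * (M * M.den) := by ring
      _ = M.num * (M' * M'.den) := by rw [e1, e2]; ring
      _ = _ := by ring
  · push_cast
    exact mul_ne_zero (mul_ne_zero h2 h1) hM

lemma Adm.add_right {y ψ ψ' : Fin n → ℚ} (h : Adm H y ψ) (h' : Adm H y ψ') :
    Adm H y (ψ + ψ') := by
  obtain ⟨h0, M, hM, z, hz, hzM⟩ := h
  obtain ⟨h0', M', hM', z', hz', hzM'⟩ := h'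
  obtain ⟨a, b, hab, hne⟩ := exists_int_mul_eq_int_mul hM hM'
  refine ⟨by rw [add_dotProduct, h0, h0', add_zero], a * M, hne, z ^ a * z' ^ b,
    mul_mem (zpow_mem hz _) (zpow_mem hz' _), ?_⟩
  have e : vecMulVec y ψ * vecMulVec y ψ' = 0 := by rw [vecMulVec_mul_vecMulVec, h0]; simp
  rw [map_mul, castMat_zpow h0 hzM, castMat_zpow h0' hzM', ← hab, vecMulVec_add, smul_add,
    mul_add, mul_one, add_mul, one_mul, smul_mul_smul_comm, e, smul_zero, add_zero, add_assoc]

lemma Adm.add_left {y y' ψ : Fin n → ℚ} (h : Adm H y ψ) (h' : Adm H y' ψ) :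
    Adm H (y + y') ψ := by
  obtain ⟨h0, M, hM, z, hz, hzM⟩ := h
  obtain ⟨h0', M', hM', z', hz', hzM'⟩ := h'
  obtain ⟨a, b, hab, hne⟩ := exists_int_mul_eq_int_mul hM hM'
  refine ⟨by rw [dotProduct_add, h0, h0', add_zero], a * M, hne, z ^ a * z' ^ b,
    mul_mem (zpow_mem hz _) (zpow_mem hz' _), ?_⟩
  have e : vecMulVec y ψ * vecMulVec y' ψ = 0 := by rw [vecMulVec_mul_vecMulVec, h0']; simp
  rw [map_mul, castMat_zpow h0 hzM, castMat_zpow h0' hzM', ← hab, add_vecMulVec, smul_add,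
    mul_add, mul_one, add_mul, one_mul, smul_mul_smul_comm, e, smul_zero, add_zero, add_assoc]

lemma Adm.conj {y ψ : Fin n → ℚ} (hA : Adm H y ψ) {h : SLZ n} (hh : h ∈ H) :
    Adm H (castMat ℚ h *ᵥ y) (ψ ᵥ* castMat ℚ h⁻¹) := by
  obtain ⟨h0, M, hM, z, hz, hzM⟩ := hA
  exact ⟨by rw [vecMul_inv_dot_mulVec, h0], M, hM, h * z * h⁻¹,
    mul_mem (mul_mem hh hz) (inv_mem hh), castMat_conj hzM h⟩

/-- The commutator of two transvections, one of whose directions is fixed by the other. -/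
lemma Adm.commutator {x α y β : Fin n → ℚ} (hx : Adm H x α) (hy : Adm H y β)
    (h0 : α ⬝ᵥ y = 0) (h1 : β ⬝ᵥ x ≠ 0) : Adm H y α := by
  obtain ⟨hxα, a, ha, z, hz, hzM⟩ := hx
  obtain ⟨hyβ, b, hb, w, hw, hwM⟩ := hy
  refine ⟨h0, -(a * b * (β ⬝ᵥ x)), neg_ne_zero.2 (mul_ne_zero (mul_ne_zero ha hb) h1),
    z * w * z⁻¹ * w⁻¹, mul_mem (mul_mem (mul_mem hz hw) (inv_mem hz)) (inv_mem hw), ?_⟩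
  have hzi := castMat_zpow hxα hzM (-1)
  have hwi := castMat_zpow hyβ hwM (-1)
  rw [_root_.zpow_neg_one] at hzi hwi
  have hXX := smul_vecMulVec_mul_self hxα a
  have hYY := smul_vecMulVec_mul_self hyβ b
  have hXY : (a • vecMulVec x α) * (b • vecMulVec y β) = 0 := by
    rw [smul_mul_assoc, mul_smul_comm, vecMulVec_mul_vecMulVec, h0]; simp
  have hYX : (b • vecMulVec y β) * (a • vecMulVec x α) =
      (a * b * (β ⬝ᵥ x)) • vecMulVec y α := by
    rw [smul_mul_assoc, mul_smul_comm, vecMulVec_mul_vecMulVec, vecMulVec_smul, smul_smul,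
      smul_smul]
    congr 1; ring
  rw [map_mul, map_mul, map_mul, hzM, hwM, hzi, hwi, neg_smul, ← hYX]
  simp only [Int.cast_neg, Int.cast_one, neg_mul, one_mul, neg_smul]
  generalize a • vecMulVec x α = X at *
  generalize b • vecMulVec y β = Y at *
  have e1 : (1 + X) * (1 + Y) = 1 + X + Y := by
    calc (1 + X) * (1 + Y) = 1 + X + Y + X * Y := by noncomm_ring
      _ = _ := by rw [hXY, add_zero]
  have e2 : (1 + -X) * (1 + -Y) = 1 - X - Y := by
    calc (1 + -X) * (1 + -Y) = 1 - X - Y + X * Y := by noncomm_ring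
      _ = _ := by rw [hXY, add_zero]
  calc (1 + X) * (1 + Y) * (1 + -X) * (1 + -Y)
      = (1 + X + Y) * (1 - X - Y) := by rw [mul_assoc, e1, e2]
    _ = 1 - X * X - X * Y - Y * X - Y * Y := by noncomm_ring
    _ = 1 + -(Y * X) := by rw [hXX, hXY, hYY]; simp [sub_eq_add_neg]

lemma exists_int_multiple (v : Fin n → ℚ) :
    ∃ c : ℚ, c ≠ 0 ∧ ∃ w : Fin n → ℤ, castVec ℚ w = c • v := by
  obtain ⟨b, hb⟩ := IsLocalization.exist_integer_multiples_of_finite (nonZeroDivisors ℤ) v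
  choose w hw using hb
  refine ⟨((b : ℤ) : ℚ), by exact_mod_cast nonZeroDivisors.coe_ne_zero b, w, ?_⟩
  ext i
  simpa [castVec] using hw i

lemma dot_self_ne_zero {K : Type*} [Field K] [LinearOrder K] [IsStrictOrderedRing K]
    {v : Fin n → K} (hv : v ≠ 0) : v ⬝ᵥ v ≠ 0 := fun h => hv (dotProduct_self_eq_zero.1 h)

/-- Congruence approximation by elements of a profinitely dense subgroup. -/
lemma ProfinitelyDense.exists_castMat_eq {Γ : Subgroup (SLZ n)} (hΓ : ProfinitelyDense Γ)
    (h₀ : SLZ n) (m : ℕ) [NeZero m] : ∃ h ∈ Γ, castMat (ZMod m) h = castMat (ZMod m) h₀ ∧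
      castMat (ZMod m) h⁻¹ = castMat (ZMod m) h₀⁻¹ := by
  let f : SLZ n →* Matrix.SpecialLinearGroup (Fin n) (ZMod m) :=
    Matrix.SpecialLinearGroup.map (Int.castRingHom (ZMod m))
  have hfin : Finite (Matrix.SpecialLinearGroup (Fin n) (ZMod m)) := Subtype.finite
  have htop := hΓ f.ker inferInstance inferInstance
  have hmem : h₀ ∈ Γ ⊔ f.ker := htop ▸ Subgroup.mem_top h₀
  obtain ⟨h, hh, k, hk, rfl⟩ := Subgroup.mem_sup_of_normal_right.1 hmem
  have hval : ∀ z : SLZ n, castMat (ZMod m) z = (f z).1 := fun z => rfl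
  refine ⟨h, hh, ?_, ?_⟩
  · rw [hval, hval, map_mul, MonoidHom.mem_ker.1 hk, mul_one]
  · rw [hval, hval, map_inv, map_inv, map_mul, MonoidHom.mem_ker.1 hk, mul_one]

lemma exists_dot_mulVec_ne_zero {Γ : Subgroup (SLZ n)} (hΓ : ProfinitelyDense Γ)
    {p l : Fin n → ℤ} (hp : p ≠ 0) (hl : l ≠ 0) : ∃ h ∈ Γ, l ⬝ᵥ (h.1 *ᵥ p) ≠ 0 := by
  obtain ⟨h₀, hh₀⟩ : ∃ h₀ : SLZ n, l ⬝ᵥ (h₀.1 *ᵥ p) ≠ 0 := by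
    by_cases h0 : l ⬝ᵥ p = 0
    · obtain ⟨u, hu⟩ := exists_isTv (x := l) (φ := p) (by rw [dotProduct_comm]; exact h0)
      refine ⟨u, ?_⟩
      rw [hu.2, add_mulVec, one_mulVec, vecMulVec_mulVec, dotProduct_add, h0, zero_add,
        op_smul_eq_smul, dotProduct_smul]
      exact mul_ne_zero (fun h => hp (dotProduct_self_eq_zero.1 h))
        (fun h => hl (dotProduct_self_eq_zero.1 h))
    · exact ⟨1, by change l ⬝ᵥ ((1 : Matrix (Fin n) (Fin n) ℤ) *ᵥ p) ≠ 0; rwa [one_mulVec]⟩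
  obtain ⟨h, hh, he, -⟩ := hΓ.exists_castMat_eq h₀ ((l ⬝ᵥ (h₀.1 *ᵥ p)).natAbs + 1)
  refine ⟨h, hh, fun h0 => hh₀ ?_⟩
  have hcast : ((l ⬝ᵥ (h₀.1 *ᵥ p) : ℤ) : ZMod ((l ⬝ᵥ (h₀.1 *ᵥ p)).natAbs + 1)) = 0 := by
    rw [← castVec_dot, ← castMat_mulVec, ← he, castMat_mulVec, castVec_dot, h0, Int.cast_zero]
  rw [ZMod.intCast_zmod_eq_zero_iff_dvd] at hcast
  exact Int.eq_zero_of_abs_lt_dvd hcast (by push_cast; omega)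

lemma gram_ne_zero {a b : Fin n → ℤ} (hind : ∀ r s : ℤ, r • a = s • b → r = 0 ∧ s = 0) :
    (a ⬝ᵥ a) * (b ⬝ᵥ b) - (a ⬝ᵥ b) * (b ⬝ᵥ a) ≠ 0 := by
  intro h
  have hw : ((a ⬝ᵥ b) • a - (a ⬝ᵥ a) • b) ⬝ᵥ ((a ⬝ᵥ b) • a - (a ⬝ᵥ a) • b) = 0 := by
    simp only [sub_dotProduct, dotProduct_sub, smul_dotProduct, dotProduct_smul, smul_eq_mul]
    rw [dotProduct_comm b a] at h ⊢
    linear_combination (a ⬝ᵥ a) * h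
  have h2 := hind _ _ (sub_eq_zero.1 (dotProduct_self_eq_zero.1 hw))
  have ha : a = 0 := dotProduct_self_eq_zero.1 h2.2
  exact one_ne_zero (hind 1 0 (by simp [ha])).1

/-- A profinitely dense subgroup contains an element moving the pencil spanned by `γ₁, γ₂` into
general position with respect to `p` and `x`. -/
lemma exists_general_position {Γ : Subgroup (SLZ n)} (hΓ : ProfinitelyDense Γ)
    {p x γ₁ γ₂ : Fin n → ℤ} (hp : p ≠ 0) (hx : x ≠ 0) (hpx : p ⬝ᵥ x = 0)
    (hind : ∀ r s : ℤ, r • γ₁ = s • γ₂ → r = 0 ∧ s = 0)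
    (h1p : p ⬝ᵥ γ₁ = 0) (h2p : p ⬝ᵥ γ₂ = 0) (h1x : x ⬝ᵥ γ₁ = 0) (h2x : x ⬝ᵥ γ₂ = 0) :
    ∃ h ∈ Γ, γ₁ ⬝ᵥ (h.1 *ᵥ p) ≠ 0 ∧
      (γ₁ ⬝ᵥ ((h⁻¹).1 *ᵥ p)) * (γ₂ ⬝ᵥ ((h⁻¹).1 *ᵥ x)) -
        (γ₂ ⬝ᵥ ((h⁻¹).1 *ᵥ p)) * (γ₁ ⬝ᵥ ((h⁻¹).1 *ᵥ x)) ≠ 0 := by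
  have hpp : p ⬝ᵥ p ≠ 0 := fun h => hp (dotProduct_self_eq_zero.1 h)
  have hxx : x ⬝ᵥ x ≠ 0 := fun h => hx (dotProduct_self_eq_zero.1 h)
  have h11 : γ₁ ⬝ᵥ γ₁ ≠ 0 := by
    intro h
    exact one_ne_zero (hind 1 0 (by simp [dotProduct_self_eq_zero.1 h])).1
  obtain ⟨t, ht⟩ := exists_isTv h1p
  obtain ⟨s, hs⟩ := exists_isTv h2x
  have happ : ∀ v : Fin n → ℤ, (t * s).1 *ᵥ v = v + (p ⬝ᵥ v) • γ₁ + (x ⬝ᵥ v) • γ₂ := by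
    intro v
    change (t.1 * s.1) *ᵥ v = _
    rw [← mulVec_mulVec, hs.2, ht.2, add_mulVec, one_mulVec, vecMulVec_mulVec, add_mulVec,
      one_mulVec, vecMulVec_mulVec, dotProduct_add]
    simp only [op_smul_eq_smul, dotProduct_smul, h2p, smul_zero, add_zero]
    abel
  have happi : ∀ v : Fin n → ℤ,
      ((t * s)⁻¹).1 *ᵥ v = v - (p ⬝ᵥ v) • γ₁ - (x ⬝ᵥ v) • γ₂ := by
    intro v
    have e : ((t * s)⁻¹).1 * (t * s).1 = 1 := congrArg Subtype.val (inv_mul_cancel (t * s))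
    have e2 : (t * s).1 *ᵥ (v - (p ⬝ᵥ v) • γ₁ - (x ⬝ᵥ v) • γ₂) = v := by
      rw [happ]
      simp only [dotProduct_sub, dotProduct_smul, h1p, h2p, h1x, h2x, smul_zero, sub_zero]
      abel
    calc ((t * s)⁻¹).1 *ᵥ v = ((t * s)⁻¹).1 *ᵥ ((t * s).1 *ᵥ
          (v - (p ⬝ᵥ v) • γ₁ - (x ⬝ᵥ v) • γ₂)) := by rw [e2]
      _ = _ := by rw [mulVec_mulVec, e, one_mulVec]
  set P : Matrix (Fin n) (Fin n) ℤ → Matrix (Fin n) (Fin n) ℤ → ℤ := fun h h' =>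
    (γ₁ ⬝ᵥ (h *ᵥ p)) * ((γ₁ ⬝ᵥ (h' *ᵥ p)) * (γ₂ ⬝ᵥ (h' *ᵥ x)) -
      (γ₂ ⬝ᵥ (h' *ᵥ p)) * (γ₁ ⬝ᵥ (h' *ᵥ x))) with hP
  have hP0 : P (t * s).1 ((t * s)⁻¹).1 ≠ 0 := by
    have hxp : x ⬝ᵥ p = 0 := by rw [dotProduct_comm]; exact hpx
    have : P (t * s).1 ((t * s)⁻¹).1 = ((p ⬝ᵥ p) * (γ₁ ⬝ᵥ γ₁)) * ((p ⬝ᵥ p) * (x ⬝ᵥ x) *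
        ((γ₁ ⬝ᵥ γ₁) * (γ₂ ⬝ᵥ γ₂) - (γ₁ ⬝ᵥ γ₂) * (γ₂ ⬝ᵥ γ₁))) := by
      simp only [hP, happ, happi, dotProduct_add, dotProduct_sub, dotProduct_smul, hpx, hxp,
        dotProduct_comm γ₁ p, dotProduct_comm γ₁ x, dotProduct_comm γ₂ p, dotProduct_comm γ₂ x,
        h1p, h2p, h1x, h2x, smul_eq_mul]
      ring
    rw [this]
    exact mul_ne_zero (mul_ne_zero hpp h11) (mul_ne_zero (mul_ne_zero hpp hxx)
      (gram_ne_zero hind))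
  obtain ⟨h, hh, he, hei⟩ := hΓ.exists_castMat_eq (t * s)
    ((P (t * s).1 ((t * s)⁻¹).1).natAbs + 1)
  have hne : P h.1 (h⁻¹).1 ≠ 0 := by
    intro h0
    apply hP0
    have hcast : ((P (t * s).1 ((t * s)⁻¹).1 : ℤ) :
        ZMod ((P (t * s).1 ((t * s)⁻¹).1).natAbs + 1)) = 0 := by
      have h0' : ((P h.1 (h⁻¹).1 : ℤ) : ZMod ((P (t * s).1 ((t * s)⁻¹).1).natAbs + 1)) = 0 := by
        rw [h0, Int.cast_zero]
      rw [← h0']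
      generalize (P (t * s).1 ((t * s)⁻¹).1).natAbs + 1 = m at *
      simp only [hP, Int.cast_mul, Int.cast_sub, ← castVec_dot, ← castMat_mulVec, he, hei]
    rw [ZMod.intCast_zmod_eq_zero_iff_dvd] at hcast
    exact Int.eq_zero_of_abs_lt_dvd hcast (by push_cast; omega)
  exact ⟨h, hh, left_ne_zero_of_mul hne, right_ne_zero_of_mul hne⟩

end Admissible

section Generic

variable {n : ℕ} {H : Subgroup (SLZ n)}

lemma exists_dot_eq_zero {K : Type*} [Field K] {W : Submodule K (Fin n → K)} (hW : W ≠ ⊤) :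
    ∃ x : Fin n → K, x ≠ 0 ∧ ∀ w ∈ W, x ⬝ᵥ w = 0 := by
  obtain ⟨f, hf, hle⟩ := Submodule.exists_le_ker_of_lt_top W (lt_top_iff_ne_top.2 hW)
  have hfx : ∀ w, (fun i => f (Pi.single i 1)) ⬝ᵥ w = f w := by
    intro w
    conv_rhs => rw [pi_eq_sum_univ' w]
    simp [dotProduct, map_sum, mul_comm]
  refine ⟨fun i => f (Pi.single i 1), fun h => hf ?_, fun w hw => by rw [hfx]; exact hle hw⟩
  ext i
  simpa using congrFun h i

/-- All transvections with direction `y` are admissible. -/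
def AdmFull (H : Subgroup (SLZ n)) (y : Fin n → ℚ) : Prop := ∀ ψ, ψ ⬝ᵥ y = 0 → Adm H y ψ

/-- The covectors admissible with a given direction. -/
def admCovectors (H : Subgroup (SLZ n)) (y : Fin n → ℚ) : Submodule ℚ (Fin n → ℚ) where
  carrier := {ψ | Adm H y ψ}
  add_mem' := Adm.add_right
  zero_mem' := adm_zero_right y
  smul_mem' c _ h := Adm.smul_right h c

lemma admFull_of_independent {Γ : Subgroup (SLZ n)} (hΓ : ProfinitelyDense Γ) (hΓH : Γ ≤ H)
    {p γ₁ γ₂ : Fin n → ℤ} (hp : p ≠ 0) (h₁ : Adm H (castVec ℚ p) (castVec ℚ γ₁))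
    (h₂ : Adm H (castVec ℚ p) (castVec ℚ γ₂))
    (hind : ∀ r s : ℤ, r • γ₁ = s • γ₂ → r = 0 ∧ s = 0) : AdmFull H (castVec ℚ p) := by
  intro ψ₀ hψ₀
  by_contra hcon
  have hp' : castVec ℚ p ≠ 0 := castVec_ne_zero hp
  have hpp := dot_self_ne_zero hp'
  have htop : admCovectors H (castVec ℚ p) ⊔ Submodule.span ℚ {castVec ℚ p} ≠ ⊤ := by
    intro h
    obtain ⟨w, hw, z, hz, hwz⟩ := Submodule.mem_sup.1 (h ▸ Submodule.mem_top (x := ψ₀))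
    obtain ⟨c, rfl⟩ := Submodule.mem_span_singleton.1 hz
    have hw0 : w ⬝ᵥ castVec ℚ p = 0 := hw.1
    rw [← hwz, add_dotProduct, hw0, zero_add, smul_dotProduct, smul_eq_mul] at hψ₀
    have hc : c = 0 := (mul_eq_zero.1 hψ₀).resolve_right hpp
    rw [hc, zero_smul, add_zero] at hwz
    exact hcon (hwz ▸ hw)
  obtain ⟨x₀, hx₀, hx₀W⟩ := exists_dot_eq_zero htop
  obtain ⟨c, hc, x, hx⟩ := exists_int_multiple x₀
  have hxW : ∀ w, Adm H (castVec ℚ p) w → castVec ℚ x ⬝ᵥ w = 0 := fun w hw => by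
    rw [hx, smul_dotProduct, hx₀W w (Submodule.mem_sup_left hw), smul_zero]
  have hxp : castVec ℚ x ⬝ᵥ castVec ℚ p = 0 := by
    rw [hx, smul_dotProduct,
      hx₀W _ (Submodule.mem_sup_right (Submodule.mem_span_singleton_self _)), smul_zero]
  have hx0 : x ≠ 0 := by
    rintro rfl
    have h0 : castVec ℚ (0 : Fin n → ℤ) = 0 := by ext; simp [castVec]
    exact smul_ne_zero hc hx₀ (hx.symm.trans h0)
  have h_orth : ∀ {a b : Fin n → ℤ}, castVec ℚ a ⬝ᵥ castVec ℚ b = 0 → a ⬝ᵥ b = 0 := by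
    intro a b h
    rw [castVec_dot] at h
    exact_mod_cast h
  obtain ⟨h, hh, hne, hgp⟩ := exists_general_position hΓ hp hx0
    (by rw [dotProduct_comm]; exact h_orth hxp) hind
    (by rw [dotProduct_comm]; exact h_orth h₁.1) (by rw [dotProduct_comm]; exact h_orth h₂.1)
    (h_orth (hxW _ h₁)) (h_orth (hxW _ h₂))
  set a : ℤ := γ₁ ⬝ᵥ ((h⁻¹).1 *ᵥ p) with ha
  set b : ℤ := γ₂ ⬝ᵥ ((h⁻¹).1 *ᵥ p) with hb
  set γ : Fin n → ℚ := (a : ℚ) • castVec ℚ γ₂ + (-(b : ℚ)) • castVec ℚ γ₁ with hγ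
  have hγA : Adm H (castVec ℚ p) γ := (h₂.smul_right _).add_right (h₁.smul_right _)
  have hα := hγA.conj (hΓH hh)
  have hαp : (γ ᵥ* castMat ℚ h⁻¹) ⬝ᵥ castVec ℚ p = 0 := by
    rw [← dotProduct_mulVec, castMat_mulVec, hγ, add_dotProduct, smul_dotProduct, smul_dotProduct,
      castVec_dot, castVec_dot, ← ha, ← hb, smul_eq_mul, smul_eq_mul]
    ring
  have hβ : castVec ℚ γ₁ ⬝ᵥ (castMat ℚ h *ᵥ castVec ℚ p) ≠ 0 := by
    rw [castMat_mulVec, castVec_dot]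
    exact_mod_cast hne
  have hfin := hxW _ (hα.commutator h₁ hαp hβ)
  rw [dotProduct_comm, ← dotProduct_mulVec, castMat_mulVec, hγ, add_dotProduct, smul_dotProduct,
    smul_dotProduct, castVec_dot, castVec_dot, smul_eq_mul, smul_eq_mul] at hfin
  apply hgp
  have : (((a * (γ₂ ⬝ᵥ ((h⁻¹).1 *ᵥ x)) - b * (γ₁ ⬝ᵥ ((h⁻¹).1 *ᵥ x)) : ℤ)) : ℚ) = 0 := by
    push_cast
    linear_combination hfin
  exact_mod_cast this

lemma AdmFull.smul {y : Fin n → ℚ} (h : AdmFull H y) (c : ℚ) : AdmFull H (c • y) := by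
  intro ψ hψ
  by_cases hc : c = 0
  · subst hc; rw [zero_smul]; exact adm_zero_left ψ
  rw [dotProduct_smul] at hψ
  exact (h ψ ((smul_eq_zero.1 hψ).resolve_left hc)).smul_left c

lemma AdmFull.conj {y : Fin n → ℚ} (hy : AdmFull H y) {h : SLZ n} (hh : h ∈ H) :
    AdmFull H (castMat ℚ h *ᵥ y) := by
  intro ψ hψ
  have := (hy (ψ ᵥ* castMat ℚ h) (by rw [← dotProduct_mulVec, hψ])).conj hh
  rwa [vecMul_vecMul, castMat_mul_inv, vecMul_one] at this

lemma AdmFull.add {q₁ q₂ q₃ : Fin n → ℚ} (h₁ : AdmFull H q₁) (h₂ : AdmFull H q₂)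
    (h₃ : AdmFull H q₃) (hq : q₃ ∉ Submodule.span ℚ {q₁, q₂}) : AdmFull H (q₁ + q₂) := by
  have hboth : ∀ ψ, ψ ⬝ᵥ q₁ = 0 → ψ ⬝ᵥ q₂ = 0 → Adm H (q₁ + q₂) ψ := fun ψ e₁ e₂ =>
    (h₁ ψ e₁).add_left (h₂ ψ e₂)
  obtain ⟨f, hf3, hf⟩ : ∃ f : (Fin n → ℚ) →ₗ[ℚ] ℚ, f q₃ ≠ 0 ∧
      Submodule.span ℚ {q₁, q₂} ≤ LinearMap.ker f :=
    Submodule.exists_le_ker_of_notMem hq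
  obtain ⟨β, hβ⟩ : ∃ β : Fin n → ℚ, ∀ w, β ⬝ᵥ w = f w := by
    refine ⟨fun i => f (Pi.single i 1), fun w => ?_⟩
    conv_rhs => rw [pi_eq_sum_univ' w]
    simp [dotProduct, map_sum, mul_comm]
  have hβ₁ : β ⬝ᵥ q₁ = 0 := by rw [hβ]; exact hf (Submodule.subset_span (by simp))
  have hβ₂ : β ⬝ᵥ q₂ = 0 := by rw [hβ]; exact hf (Submodule.subset_span (by simp))
  rw [← hβ] at hf3
  have hβA := hboth β hβ₁ hβ₂
  intro ψ hψ
  have e : ψ = ((ψ ⬝ᵥ q₃) / (β ⬝ᵥ q₃)) • β + (ψ - ((ψ ⬝ᵥ q₃) / (β ⬝ᵥ q₃)) • β) := by abel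
  rw [e]
  refine (hβA.smul_right _).add_right (Adm.commutator (h₃ _ ?_) hβA ?_ hf3)
  · rw [sub_dotProduct, smul_dotProduct, smul_eq_mul, div_mul_cancel₀ _ hf3, sub_self]
  · rw [sub_dotProduct, smul_dotProduct, hψ, dotProduct_add, hβ₁, hβ₂]
    simp

/-- Two admissible transvections with a common direction make everything admissible. -/
lemma adm_of_independent (hn : 3 ≤ n) {Γ : Subgroup (SLZ n)} (hΓ : ProfinitelyDense Γ)
    (hΓH : Γ ≤ H) {p γ₁ γ₂ : Fin n → ℤ} (hp : p ≠ 0)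
    (h₁ : Adm H (castVec ℚ p) (castVec ℚ γ₁)) (h₂ : Adm H (castVec ℚ p) (castVec ℚ γ₂))
    (hind : ∀ r s : ℤ, r • γ₁ = s • γ₂ → r = 0 ∧ s = 0) {y ψ : Fin n → ℚ}
    (hyψ : ψ ⬝ᵥ y = 0) : Adm H y ψ := by
  have hpf := admFull_of_independent hΓ hΓH hp h₁ h₂ hind
  have hspan : Submodule.span ℚ {y | AdmFull H y} = ⊤ := by
    by_contra hcon
    obtain ⟨x₀, hx₀, hx₀W⟩ := exists_dot_eq_zero hcon
    obtain ⟨c, hc, x, hx⟩ := exists_int_multiple x₀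
    have hx0 : x ≠ 0 := by
      rintro rfl
      have h0 : castVec ℚ (0 : Fin n → ℤ) = 0 := by ext; simp [castVec]
      exact smul_ne_zero hc hx₀ (hx.symm.trans h0)
    obtain ⟨h, hh, hne⟩ := exists_dot_mulVec_ne_zero hΓ hp hx0
    apply hne
    have := hx₀W _ (Submodule.subset_span (hpf.conj (hΓH hh)))
    have h2 : castVec ℚ x ⬝ᵥ castVec ℚ (h.1 *ᵥ p) = 0 := by
      rw [hx, smul_dotProduct, ← castMat_mulVec, this, smul_zero]
    rw [castVec_dot] at h2
    exact_mod_cast h2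
  have hadd : ∀ q₁ q₂, AdmFull H q₁ → AdmFull H q₂ → AdmFull H (q₁ + q₂) := by
    intro q₁ q₂ e₁ e₂
    by_contra hcon
    have hle : Submodule.span ℚ {y | AdmFull H y} ≤ Submodule.span ℚ {q₁, q₂} := by
      rw [Submodule.span_le]
      intro q₃ h₃
      by_contra h
      exact hcon (e₁.add e₂ h₃ h)
    have hrank : Module.finrank ℚ (Submodule.span ℚ ({q₁, q₂} : Set (Fin n → ℚ))) ≤ 2 := by
      have := finrank_span_finset_le_card (R := ℚ) ({q₁, q₂} : Finset (Fin n → ℚ))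
      rw [Finset.coe_pair] at this
      exact this.trans Finset.card_le_two
    rw [hspan, top_le_iff] at hle
    rw [hle, finrank_top, Module.finrank_fin_fun] at hrank
    omega
  have hall : ∀ y, AdmFull H y := by
    intro y
    have hy : y ∈ Submodule.span ℚ {y | AdmFull H y} := hspan ▸ Submodule.mem_top
    induction hy using Submodule.span_induction with
    | mem x hx => exact hx
    | zero => exact fun ψ _ => adm_zero_left ψ
    | add a b _ _ ha hb => exact hadd a b ha hb
    | smul c a _ ha => exact ha.smul c
  exact hall y ψ hyψ

end Generic

section Metric

variable {n : ℕ} {d : Proj n → Proj n → ℝ}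

lemma IsCompatMetric.nonneg (hd : IsCompatMetric d) (x y : Proj n) : 0 ≤ d x y := by
  have h := hd.triangle x y x
  rw [hd.self, hd.symm y x] at h
  linarith

lemma IsCompatMetric.bddBelow (hd : IsCompatMetric d) (x : Proj n) (A : Set (Proj n)) :
    BddBelow (d x '' A) := ⟨0, by rintro _ ⟨y, -, rfl⟩; exact hd.nonneg x y⟩

lemma IsCompatMetric.setDist_lt (hd : IsCompatMetric d) {x : Proj n} {A : Set (Proj n)}
    (hA : A.Nonempty) {r : ℝ} : setDist d x A < r ↔ ∃ a ∈ A, d x a < r := by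
  rw [setDist, csInf_lt_iff (hd.bddBelow x A) (hA.image _)]
  simp

lemma IsCompatMetric.setDist_le (hd : IsCompatMetric d) (x : Proj n) {A : Set (Proj n)}
    {a : Proj n} (ha : a ∈ A) : setDist d x A ≤ d x a :=
  csInf_le (hd.bddBelow x A) ⟨a, ha, rfl⟩

lemma IsCompatMetric.setDist_le_add (hd : IsCompatMetric d) (x y : Proj n) {A : Set (Proj n)}
    (hA : A.Nonempty) : setDist d x A ≤ d x y + setDist d y A := by
  rw [← sub_le_iff_le_add']
  refine le_csInf (hA.image _) ?_
  rintro _ ⟨a, ha, rfl⟩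
  rw [sub_le_iff_le_add']
  exact (hd.setDist_le x ha).trans (hd.triangle x y a)

lemma IsCompatMetric.isClosed_cThick (hd : IsCompatMetric d) {A : Set (Proj n)}
    (hA : A.Nonempty) (r : ℝ) : IsClosed (cThick d A r) := by
  rw [← isOpen_compl_iff, hd.inducing]
  intro x hx
  have hx' : r < setDist d x A := not_le.1 hx
  refine ⟨setDist d x A - r, sub_pos.2 hx', fun y hy (hyr : setDist d y A ≤ r) => ?_⟩
  have := hd.setDist_le_add x y hA
  linarith

lemma IsCompatMetric.isOpen_ball (hd : IsCompatMetric d) (x : Proj n) (r : ℝ) :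
    IsOpen {y | d x y < r} := by
  rw [hd.inducing]
  intro y hy
  refine ⟨r - d x y, sub_pos.2 hy, fun z hz => ?_⟩
  have := hd.triangle x y z
  change d x z < r
  linarith

lemma continuous_mk : Continuous
    (fun v : {v : Fin n → ℝ // v ≠ 0} => (Projectivization.mk ℝ v.1 v.2 : Proj n)) :=
  continuous_quotient_mk'

lemma isOpen_mk_mem {U : Set (Proj n)} (hU : IsOpen U) :
    IsOpen {v : Fin n → ℝ | ∃ h : v ≠ 0, Projectivization.mk ℝ v h ∈ U} := by
  have h1 := hU.preimage continuous_mk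
  have h2 : IsOpen {v : Fin n → ℝ | v ≠ 0} := isOpen_ne
  have h3 := h2.isOpenMap_subtype_val _ h1
  convert h3 using 1
  ext v
  simp

lemma IsCompatMetric.exists_near (hd : IsCompatMetric d) {y : Fin n → ℝ} (hy : y ≠ 0) {η : ℝ}
    (hη : 0 < η) : ∃ κ > 0, ∀ v : Fin n → ℝ, ‖v - y‖ < κ →
      ∃ h : v ≠ 0, d (Projectivization.mk ℝ y hy) (Projectivization.mk ℝ v h) < η := by
  have ho := isOpen_mk_mem (hd.isOpen_ball (Projectivization.mk ℝ y hy) η)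
  obtain ⟨κ, hκ, hb⟩ := Metric.isOpen_iff.1 ho y ⟨hy, by
    change d _ _ < η
    rwa [hd.self]⟩
  exact ⟨κ, hκ, fun v hv => hb (by rwa [mem_ball_iff_norm])⟩

lemma IsCompatMetric.exists_uniform_near (hd : IsCompatMetric d) {η : ℝ} (hη : 0 < η) :
    ∃ κ > 0, ∀ v v' : Fin n → ℝ, ∀ h : v ≠ 0, ‖v‖ = 1 → ‖v' - v‖ < κ →
      ∃ h' : v' ≠ 0, d (Projectivization.mk ℝ v h) (Projectivization.mk ℝ v' h') < η := by
  obtain ⟨κ, hκ, hb⟩ := lebesgue_number_lemma_of_metric (isCompact_sphere (0 : Fin n → ℝ) 1)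
    (fun z : Proj n => isOpen_mk_mem (hd.isOpen_ball z (η / 2))) (by
      intro v hv
      have hv0 : v ≠ 0 := by
        rintro rfl
        simp at hv
      refine Set.mem_iUnion.2 ⟨Projectivization.mk ℝ v hv0, hv0, ?_⟩
      change d _ _ < η / 2
      rw [hd.self]
      linarith)
  refine ⟨κ, hκ, fun v v' h hv hv' => ?_⟩
  obtain ⟨z, hz⟩ := hb v (by rw [mem_sphere_zero_iff_norm, hv])
  obtain ⟨h1, hz1⟩ := hz (Metric.mem_ball_self hκ)
  obtain ⟨h2, hz2⟩ := hz (show v' ∈ Metric.ball v κ by rwa [mem_ball_iff_norm])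
  refine ⟨h2, ?_⟩
  have e1 : d z (Projectivization.mk ℝ v h) < η / 2 := hz1
  have e2 : d z (Projectivization.mk ℝ v' h2) < η / 2 := hz2
  have := hd.triangle (Projectivization.mk ℝ v h) z (Projectivization.mk ℝ v' h2)
  rw [hd.symm _ z] at this
  linarith

/-- The subspace orthogonal to `ψ`. -/
def perp (ψ : Fin n → ℝ) : Submodule ℝ (Fin n → ℝ) where
  carrier := {v | ψ ⬝ᵥ v = 0}
  add_mem' {a b} ha hb := by
    change ψ ⬝ᵥ (a + b) = 0
    rw [dotProduct_add, show ψ ⬝ᵥ a = 0 from ha, show ψ ⬝ᵥ b = 0 from hb, add_zero]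
  zero_mem' := dotProduct_zero ψ
  smul_mem' c a ha := by
    change ψ ⬝ᵥ (c • a) = 0
    rw [dotProduct_smul, show ψ ⬝ᵥ a = 0 from ha, smul_zero]

lemma mem_perp {ψ v : Fin n → ℝ} : v ∈ perp ψ ↔ ψ ⬝ᵥ v = 0 := Iff.rfl

lemma mk_mem_projSet {W : Submodule ℝ (Fin n → ℝ)} {v : Fin n → ℝ} (hv : v ≠ 0) :
    Projectivization.mk ℝ v hv ∈ projSet W ↔ v ∈ W := by
  change (Projectivization.mk ℝ v hv).submodule ≤ W ↔ _
  rw [Projectivization.submodule_mk, Submodule.span_singleton_le_iff_mem]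

lemma exists_unit_rep (z : Proj n) :
    ∃ (v : Fin n → ℝ) (h : v ≠ 0), ‖v‖ = 1 ∧ z = Projectivization.mk ℝ v h := by
  induction z using Projectivization.ind with
  | h v hv =>
    have hn : ‖v‖ ≠ 0 := norm_ne_zero_iff.2 hv
    refine ⟨‖v‖⁻¹ • v, smul_ne_zero (inv_ne_zero hn) hv, ?_, ?_⟩
    · rw [norm_smul, norm_inv, norm_norm, inv_mul_cancel₀ hn]
    · rw [Projectivization.mk_eq_mk_iff']
      exact ⟨‖v‖, by rw [smul_smul, mul_inv_cancel₀ hn, one_smul]⟩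

lemma abs_dotProduct_le (v w : Fin n → ℝ) : |v ⬝ᵥ w| ≤ n * (‖v‖ * ‖w‖) := by
  calc |v ⬝ᵥ w| ≤ ∑ i, |v i * w i| := Finset.abs_sum_le_sum_abs _ _
    _ ≤ ∑ _i : Fin n, ‖v‖ * ‖w‖ := Finset.sum_le_sum fun i _ => by
        rw [abs_mul]
        exact mul_le_mul (norm_le_pi_norm v i) (norm_le_pi_norm w i) (abs_nonneg _) (norm_nonneg _)
    _ = n * (‖v‖ * ‖w‖) := by simp

lemma sq_norm_le_dot_self (v : Fin n → ℝ) : ‖v‖ ^ 2 ≤ v ⬝ᵥ v := by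
  have h0 : 0 ≤ v ⬝ᵥ v := Finset.sum_nonneg fun i _ => mul_self_nonneg (v i)
  have h : ‖v‖ ≤ √(v ⬝ᵥ v) := by
    rw [pi_norm_le_iff_of_nonneg (Real.sqrt_nonneg _)]
    intro i
    rw [Real.norm_eq_abs]
    refine Real.abs_le_sqrt ?_
    rw [pow_two]
    exact Finset.single_le_sum (f := fun i => v i * v i) (fun i _ => mul_self_nonneg (v i))
      (Finset.mem_univ i)
  calc ‖v‖ ^ 2 ≤ √(v ⬝ᵥ v) ^ 2 := by gcongr
    _ = v ⬝ᵥ v := Real.sq_sqrt h0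

/-- A direction almost annihilated by a covector is close to its hyperplane. -/
lemma IsCompatMetric.exists_near_perp (hd : IsCompatMetric d) {η : ℝ} (hη : 0 < η) :
    ∃ κ > 0, ∀ ψ v : Fin n → ℝ, ∀ h : v ≠ 0, ψ ≠ 0 → ‖v‖ = 1 → |ψ ⬝ᵥ v| < κ * ‖ψ‖ →
      ∃ z ∈ projSet (perp ψ), d (Projectivization.mk ℝ v h) z < η := by
  obtain ⟨κ, hκ, hb⟩ := hd.exists_uniform_near hη
  refine ⟨κ, hκ, fun ψ v h hψ hv hlt => ?_⟩
  have hn : 0 < ‖ψ‖ := norm_pos_iff.2 hψ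
  have hsq := sq_norm_le_dot_self ψ
  have hpos : 0 < ψ ⬝ᵥ ψ := lt_of_lt_of_le (by positivity) hsq
  obtain ⟨h', hlt'⟩ := hb v (v - ((ψ ⬝ᵥ v) / (ψ ⬝ᵥ ψ)) • ψ) h hv (by
    rw [sub_sub_cancel_left, norm_neg, norm_smul, Real.norm_eq_abs, abs_div, abs_of_pos hpos,
      div_mul_eq_mul_div, div_lt_iff₀ hpos]
    calc |ψ ⬝ᵥ v| * ‖ψ‖ < κ * ‖ψ‖ * ‖ψ‖ := by gcongr
      _ = κ * ‖ψ‖ ^ 2 := by ring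
      _ ≤ κ * (ψ ⬝ᵥ ψ) := by gcongr)
  refine ⟨_, (mk_mem_projSet h').2 ?_, hlt'⟩
  rw [mem_perp, dotProduct_sub, dotProduct_smul, smul_eq_mul, div_mul_cancel₀ _ hpos.ne', sub_self]

/-- Nearby covectors have nearby hyperplanes. -/
lemma IsCompatMetric.exists_perp_near (hd : IsCompatMetric d) {ψ : Fin n → ℝ} (hψ : ψ ≠ 0) {η : ℝ}
    (hη : 0 < η) : ∃ κ > 0, ∀ φ : Fin n → ℝ, ‖φ - ψ‖ < κ → ∀ z ∈ projSet (perp φ),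
      ∃ w ∈ projSet (perp ψ), d z w < η := by
  obtain ⟨κ, hκ, hb⟩ := hd.exists_near_perp hη
  have hn : 0 < ‖ψ‖ := norm_pos_iff.2 hψ
  refine ⟨κ * ‖ψ‖ / (n + 1), by positivity, fun φ hφ z hz => ?_⟩
  obtain ⟨v, h, hv, rfl⟩ := exists_unit_rep z
  refine hb ψ v h hψ hv ?_
  have hφv : φ ⬝ᵥ v = 0 := (mk_mem_projSet h).1 hz
  have e : ψ ⬝ᵥ v = -((φ - ψ) ⬝ᵥ v) := by rw [sub_dotProduct, hφv]; ring
  rw [lt_div_iff₀ (by positivity)] at hφ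
  calc |ψ ⬝ᵥ v| ≤ n * (‖φ - ψ‖ * ‖v‖) := by rw [e, abs_neg]; exact abs_dotProduct_le _ _
    _ = ‖φ - ψ‖ * n := by rw [hv]; ring
    _ ≤ ‖φ - ψ‖ * (n + 1) := by gcongr; linarith
    _ < κ * ‖ψ‖ := hφ

lemma isClosed_projSet_perp (ψ : Fin n → ℝ) : IsClosed (projSet (perp ψ)) := by
  have hc : IsClosed {v : {v : Fin n → ℝ // v ≠ 0} | ψ ⬝ᵥ v.1 = 0} := by
    refine isClosed_eq ?_ continuous_const
    exact continuous_finsetSum _ fun i _ =>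
      continuous_const.mul ((continuous_apply i).comp continuous_subtype_val)
  rw [← isOpen_compl_iff] at hc ⊢
  refine isOpen_coinduced.2 ?_
  convert hc using 1
  ext v
  exact not_congr (mk_mem_projSet v.2)

lemma IsCompatMetric.exists_far_perp (hd : IsCompatMetric d) {y ψ : Fin n → ℝ} (hy : y ≠ 0)
    (h : ψ ⬝ᵥ y ≠ 0) :
    ∃ η > 0, ∀ w ∈ projSet (perp ψ), η ≤ d (Projectivization.mk ℝ y hy) w := by
  obtain ⟨η, hη, hb⟩ := (hd.inducing _).1 (isClosed_projSet_perp ψ).isOpen_compl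
    (Projectivization.mk ℝ y hy) (fun hm => h ((mk_mem_projSet hy).1 hm))
  exact ⟨η, hη, fun w hw => not_lt.1 fun hlt => hb w hlt hw⟩

end Metric

section PingPong

variable {n : ℕ}

lemma range_mulVecLin_vecMulVec {K : Type*} [Field K] {x φ : Fin n → K} (hφ : φ ≠ 0) :
    LinearMap.range (mulVecLin (vecMulVec x φ)) = Submodule.span K {x} := by
  obtain ⟨i, hi⟩ := Function.ne_iff.1 hφ
  ext w
  rw [Submodule.mem_span_singleton]
  constructor
  · rintro ⟨v, rfl⟩
    exact ⟨φ ⬝ᵥ v, by rw [mulVecLin_apply, vecMulVec_mulVec, op_smul_eq_smul]⟩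
  · rintro ⟨c, rfl⟩
    refine ⟨Pi.single i (c * (φ i)⁻¹), ?_⟩
    rw [mulVecLin_apply, vecMulVec_mulVec, op_smul_eq_smul, dotProduct_single, mul_comm c,
      mul_inv_cancel_left₀ hi]

lemma ker_mulVecLin_vecMulVec {x φ : Fin n → ℝ} (hx : x ≠ 0) :
    LinearMap.ker (mulVecLin (vecMulVec x φ)) = perp φ := by
  ext v
  rw [LinearMap.mem_ker, mulVecLin_apply, vecMulVec_mulVec, op_smul_eq_smul, smul_eq_zero,
    or_iff_left hx, mem_perp]

namespace IsTv

variable {u : SLZ n} {x φ : Fin n → ℤ}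

lemma isR1U (hu : IsTv u x φ) (hx : x ≠ 0) (hφ : φ ≠ 0) : IsR1U u := by
  have e : linQ u = mulVecLin (vecMulVec (castVec ℚ x) (castVec ℚ φ)) := by
    rw [linQ, matQ_eq_castMat, castMat_vecMulVec hu.2, add_sub_cancel_left]
  refine ⟨⟨2, ?_⟩, ?_⟩
  · rw [e, pow_two, Module.End.mul_eq_comp, ← mulVecLin_mul, vecMulVec_mul_self, mulVecLin_zero]
    rw [castVec_dot, hu.1, Int.cast_zero]
  · rw [e, range_mulVecLin_vecMulVec (castVec_ne_zero hφ)]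
    exact finrank_span_singleton (castVec_ne_zero hx)

lemma attSet_eq (hu : IsTv u x φ) (hx : x ≠ 0) (hφ : φ ≠ 0) :
    attSet u = {Projectivization.mk ℝ (castVec ℝ x) (castVec_ne_zero hx)} := by
  have e : lineOf u = Submodule.span ℝ {castVec ℝ x} := by
    rw [lineOf, matR_eq_castMat, castMat_vecMulVec hu.2, add_sub_cancel_left,
      range_mulVecLin_vecMulVec (castVec_ne_zero hφ)]
  ext z
  change z.submodule = lineOf u ↔ z = _
  rw [e, ← Projectivization.submodule_mk _ (castVec_ne_zero hx)]
  exact Projectivization.submodule_injective.eq_iff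

lemma fixSet_eq (hu : IsTv u x φ) (hx : x ≠ 0) : fixSet u = projSet (perp (castVec ℝ φ)) := by
  have e : hypOf u = perp (castVec ℝ φ) := by
    rw [hypOf, matR_eq_castMat, castMat_vecMulVec hu.2, add_sub_cancel_left,
      ker_mulVecLin_vecMulVec (castVec_ne_zero hx)]
  rw [fixSet, e, projSet]

lemma act_zpow_mk (hu : IsTv u x φ) (k : ℤ) {v : Fin n → ℝ} (hv : v ≠ 0) :
    ∃ h : v + (k * (castVec ℝ φ ⬝ᵥ v)) • castVec ℝ x ≠ 0,
      act (u ^ k) (Projectivization.mk ℝ v hv) = Projectivization.mk ℝ _ h := by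
  have e : matR (u ^ k) *ᵥ v = v + (k * (castVec ℝ φ ⬝ᵥ v)) • castVec ℝ x := by
    rw [matR_eq_castMat, castMat_vecMulVec (hu.zpow k).2, add_mulVec, one_mulVec,
      vecMulVec_mulVec, op_smul_eq_smul, castVec_smul, smul_dotProduct, smul_eq_mul]
  have hne : matR (u ^ k) *ᵥ v ≠ 0 := by
    intro h
    apply hv
    rw [← one_mulVec v, ← castMat_inv_mul ℝ (u ^ k), ← mulVec_mulVec, ← matR_eq_castMat (u ^ k),
      h, mulVec_zero]
  refine ⟨e ▸ hne, ?_⟩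
  have h1 : act (u ^ k) (Projectivization.mk ℝ v hv) =
      Projectivization.mk ℝ (matR (u ^ k) *ᵥ v) hne := rfl
  rw [h1]
  simp only [e]

end IsTv

/-- The unipotent `u` plays ping-pong between the `η`-neighbourhoods of its fixed hyperplane and
attracting point, and these lie in the `2η`-neighbourhoods of the flag `(p, ker ψ)`. -/
structure PlaysNear (d : Proj n → Proj n → ℝ) (η : ℝ) (u : SLZ n) (p : Proj n)
    (ψ : Fin n → ℝ) : Prop where
  unip : IsR1U u
  attracts : ∀ k : ℤ, k ≠ 0 → ∀ z, z ∉ oThick d (fixSet u) η →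
    act (u ^ k) z ∈ oThick d (attSet u) η
  att_near : ∀ z ∈ oThick d (attSet u) η, d z p < 2 * η
  fix_near : ∀ z ∈ oThick d (fixSet u) η, ∃ w ∈ projSet (perp ψ), d z w < 2 * η

lemma exists_playsNear {d : Proj n → Proj n → ℝ} (hd : IsCompatMetric d) {y ψ : Fin n → ℝ}
    (hy : y ≠ 0) (hψ : ψ ≠ 0) {η : ℝ} (hη : 0 < η) :
    ∃ κ > 0, ∀ (u : SLZ n) (x φ : Fin n → ℤ) (a b : ℝ), IsTv u x φ → a ≠ 0 → b ≠ 0 →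
      ‖a⁻¹ • castVec ℝ x - y‖ < κ → ‖b⁻¹ • castVec ℝ φ - ψ‖ < κ → κ⁻¹ < |a * b| →
      PlaysNear d η u (Projectivization.mk ℝ y hy) ψ := by
  have hψn : 0 < ‖ψ‖ := norm_pos_iff.2 hψ
  obtain ⟨κ₁, hκ₁, h₁⟩ := hd.exists_near hy (half_pos hη)
  obtain ⟨κ₂, hκ₂, h₂⟩ := hd.exists_perp_near hψ hη
  obtain ⟨κ₃, hκ₃, h₃⟩ := hd.exists_near_perp hη
  set c : ℝ := κ₃ * (‖ψ‖ / 2) with hc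
  have hcpos : 0 < c := by positivity
  refine ⟨min (min (κ₁ / 2) κ₂) (min (‖ψ‖ / 2) (κ₁ * c / 2)), by positivity,
    fun u x φ a b hu ha hb hxa hφb hab => ?_⟩
  set κ := min (min (κ₁ / 2) κ₂) (min (‖ψ‖ / 2) (κ₁ * c / 2)) with hκ
  have hκpos : 0 < κ := by positivity
  have k1 : κ ≤ κ₁ / 2 := (min_le_left _ _).trans (min_le_left _ _)
  have k2 : κ ≤ κ₂ := (min_le_left _ _).trans (min_le_right _ _)
  have k3 : κ ≤ ‖ψ‖ / 2 := (min_le_right _ _).trans (min_le_left _ _)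
  have k4 : κ ≤ κ₁ * c / 2 := (min_le_right _ _).trans (min_le_right _ _)
  set φ' := b⁻¹ • castVec ℝ φ with hφ'
  have hφ'n : ‖ψ‖ / 2 < ‖φ'‖ := by
    have := norm_sub_norm_le ψ φ'
    rw [norm_sub_rev] at this
    linarith
  have hφ'0 : φ' ≠ 0 := norm_pos_iff.1 (lt_trans (by positivity) hφ'n)
  have hφ0 : φ ≠ 0 := by
    rintro rfl
    exact hφ'0 (by ext i; simp [hφ', castVec])
  obtain ⟨hx'0, hx'd⟩ := h₁ _ (lt_of_lt_of_le hxa (k1.trans (by linarith)))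
  have hx0 : x ≠ 0 := by
    rintro rfl
    exact hx'0 (by ext i; simp [castVec])
  have hmkx : Projectivization.mk ℝ (castVec ℝ x) (castVec_ne_zero hx0) =
      Projectivization.mk ℝ _ hx'0 := by
    rw [Projectivization.mk_eq_mk_iff']
    exact ⟨a, by rw [smul_smul, mul_inv_cancel₀ ha, one_smul]⟩
  have hperp : perp (castVec ℝ φ) = perp φ' := by
    ext v
    rw [mem_perp, mem_perp, hφ', smul_dotProduct, smul_eq_zero, or_iff_right (inv_ne_zero hb)]
  have hfix : fixSet u = projSet (perp φ') := by rw [hu.fixSet_eq hx0, hperp]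
  have hatt := hu.attSet_eq hx0 hφ0
  have hfixne : (fixSet u).Nonempty := by
    rw [hu.fixSet_eq hx0]
    refine ⟨_, (mk_mem_projSet (castVec_ne_zero hx0)).2 ?_⟩
    rw [mem_perp, castVec_dot, hu.1, Int.cast_zero]
  refine ⟨hu.isR1U hx0 hφ0, ?_, ?_, ?_⟩
  · intro k hk z hz
    obtain ⟨v, hv, hv1, rfl⟩ := exists_unit_rep z
    have hlow : c ≤ |φ' ⬝ᵥ v| := by
      by_contra hlt
      obtain ⟨w, hw, hdw⟩ := h₃ φ' v hv hφ'0 hv1 ((not_le.1 hlt).trans (by rw [hc]; gcongr))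
      exact hz ((hd.setDist_lt hfixne).2 ⟨w, hfix ▸ hw, hdw⟩)
    obtain ⟨hne, he⟩ := hu.act_zpow_mk k hv
    rw [he, hatt]
    refine (hd.setDist_lt (Set.singleton_nonempty _)).2 ⟨_, rfl, ?_⟩
    set s : ℝ := k * (castVec ℝ φ ⬝ᵥ v) with hs
    have hk1 : (1 : ℝ) ≤ |(k : ℝ)| := by exact_mod_cast Int.one_le_abs hk
    have hsa : |a * b| * c ≤ |s * a| := by
      have e : s * a = k * (a * b) * (φ' ⬝ᵥ v) := by
        rw [hs, hφ', smul_dotProduct, smul_eq_mul]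
        field_simp
      rw [e, abs_mul (k * (a * b)), abs_mul (k : ℝ)]
      calc |a * b| * c = 1 * |a * b| * c := by ring
        _ ≤ |(k : ℝ)| * |a * b| * |φ' ⬝ᵥ v| := by gcongr
    have hbig : κ⁻¹ * c < |s * a| := lt_of_lt_of_le (by gcongr) hsa
    have hsapos : 0 < |s * a| := lt_trans (by positivity) hbig
    have hsa0 : s * a ≠ 0 := abs_pos.1 hsapos
    have hs0 : s ≠ 0 := left_ne_zero_of_mul hsa0
    have hsmall : |s * a|⁻¹ < κ₁ / 2 := by
      rw [inv_lt_comm₀ hsapos (by positivity)]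
      refine lt_of_le_of_lt ?_ hbig
      rw [inv_mul_eq_div, le_div_iff₀ hκpos, inv_mul_le_iff₀ (by positivity)]
      calc κ ≤ κ₁ * c / 2 := k4
        _ = _ := by ring
    obtain ⟨hq, hqd⟩ := h₁ ((s * a)⁻¹ • (v + s • castVec ℝ x)) (by
      have e : (s * a)⁻¹ • (v + s • castVec ℝ x) - y =
          (s * a)⁻¹ • v + (a⁻¹ • castVec ℝ x - y) := by
        rw [smul_add, smul_smul, mul_inv, mul_comm s⁻¹, mul_assoc, inv_mul_cancel₀ hs0, mul_one]
        abel
      rw [e]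
      refine lt_of_le_of_lt (norm_add_le _ _) ?_
      rw [norm_smul, hv1, mul_one, norm_inv, Real.norm_eq_abs]
      linarith)
    have hmk : Projectivization.mk ℝ _ hne = Projectivization.mk ℝ _ hq := by
      rw [Projectivization.mk_eq_mk_iff']
      exact ⟨s * a, by rw [smul_smul, mul_inv_cancel₀ hsa0, one_smul]⟩
    rw [hmk, hmkx]
    have := hd.triangle (Projectivization.mk ℝ _ hq) (Projectivization.mk ℝ y hy)
      (Projectivization.mk ℝ _ hx'0)
    rw [hd.symm _ (Projectivization.mk ℝ y hy)] at this
    linarith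
  · intro z hz
    rw [hatt, hmkx] at hz
    obtain ⟨w, rfl, hw⟩ := (hd.setDist_lt (Set.singleton_nonempty _)).1 hz
    have := hd.triangle z (Projectivization.mk ℝ _ hx'0) (Projectivization.mk ℝ y hy)
    rw [hd.symm (Projectivization.mk ℝ _ hx'0)] at this
    linarith
  · intro z hz
    obtain ⟨w, hw, hzw⟩ := (hd.setDist_lt hfixne).1 hz
    rw [hfix] at hw
    obtain ⟨w', hw', hww'⟩ := h₂ φ' (hφb.trans_le k2) w hw
    exact ⟨w', hw', by have := hd.triangle z w w'; linarith⟩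

/-- Enlarging a Schottky system by finitely or infinitely many mutually transverse unipotents. -/
lemma IsSchottky.union_range {d : Proj n → Proj n → ℝ} {S : Set (SLZ n)} {A R A' R' : Set (Proj n)}
    (hS : IsSchottky d S A R) (hA' : IsClosed A') (hR' : IsClosed R') (hAR' : A' ⊆ R')
    (hA'R : A' ∩ R = ∅) (hR'A : R' ∩ A = ∅) {ι : Type*} {w : ι → SLZ n} {η : ℝ} (hη : 0 < η)
    {p : ι → Proj n} {ψ : ι → Fin n → ℝ} (hw : ∀ i, PlaysNear d η (w i) (p i) (ψ i))
    (hp : ∀ i z, d z (p i) < 2 * η → z ∈ A')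
    (hψ : ∀ i z, ∀ y ∈ projSet (perp (ψ i)), d z y < 2 * η → z ∈ R')
    (htr : ∀ i j, i ≠ j → ∀ z, ∀ y ∈ projSet (perp (ψ j)), d z (p i) < 2 * η →
      2 * η ≤ d z y) :
    IsSchottky d (S ∪ Set.range w) (A ∪ A') (R ∪ R') := by
  classical
  obtain ⟨ε, δ, h0, h1, h2, h3, h4⟩ := hS.cond
  have hatt : ∀ i, oThick d (attSet (w i)) η ⊆ A' := fun i z hz => hp i z ((hw i).att_near z hz)
  have hfix : ∀ i, oThick d (fixSet (w i)) η ⊆ R' := fun i z hz => by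
    obtain ⟨y, hy, hzy⟩ := (hw i).fix_near z hz
    exact hψ i z y hy hzy
  have hnew : ∀ u ∈ S ∪ Set.range w, u ∉ S → ∃ i, u = w i := by
    rintro u (hu | ⟨i, rfl⟩) hS
    · exact absurd hu hS
    · exact ⟨i, rfl⟩
  refine ⟨hS.nonempty.inl, ?_, Set.union_subset_union hS.AsubR hAR', hS.closedA.union hA',
    hS.closedR.union hR', fun u => if u ∈ S then ε u else η, fun u => if u ∈ S then δ u else η,
    ?_, ?_, ?_, ?_, ?_⟩
  · rintro u (hu | ⟨i, rfl⟩)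
    · exact hS.unip u hu
    · exact (hw i).unip
  · intro u hu
    by_cases huS : u ∈ S
    · simpa only [if_pos huS] using h0 u huS
    · simpa only [if_neg huS] using ⟨hη, le_refl η⟩
  · intro u hu
    by_cases huS : u ∈ S
    · simpa only [if_pos huS] using h1 u huS
    · obtain ⟨i, rfl⟩ := hnew u hu huS
      simpa only [if_neg huS] using (hw i).attracts
  · intro u hu v hv huv
    by_cases huS : u ∈ S <;> by_cases hvS : v ∈ S
    · simpa only [if_pos huS, if_pos hvS] using h2 u huS v hvS huv
    · obtain ⟨j, rfl⟩ := hnew v hv hvS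
      simp only [if_pos huS, if_neg hvS]
      rw [← Set.subset_empty_iff, ← hR'A, Set.inter_comm R']
      exact Set.inter_subset_inter (h3 u huS) (hfix j)
    · obtain ⟨i, rfl⟩ := hnew u hu huS
      simp only [if_neg huS, if_pos hvS]
      rw [← Set.subset_empty_iff, ← hA'R]
      exact Set.inter_subset_inter (hatt i) (h4 v hvS)
    · obtain ⟨i, rfl⟩ := hnew u hu huS
      obtain ⟨j, rfl⟩ := hnew v hv hvS
      simp only [if_neg huS, if_neg hvS]
      rw [Set.eq_empty_iff_forall_notMem]
      rintro z ⟨hz1, hz2⟩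
      obtain ⟨y, hy, hzy⟩ := (hw j).fix_near z hz2
      have hij : i ≠ j := fun e => huv (by rw [e])
      exact absurd hzy (not_lt.2 (htr i j hij z y hy ((hw i).att_near z hz1)))
  · intro u hu
    by_cases huS : u ∈ S
    · simpa only [if_pos huS] using (h3 u huS).trans Set.subset_union_left
    · obtain ⟨i, rfl⟩ := hnew u hu huS
      simpa only [if_neg huS] using (hatt i).trans Set.subset_union_right
  · intro u hu
    by_cases huS : u ∈ S
    · simpa only [if_pos huS] using (h4 u huS).trans Set.subset_union_left
    · obtain ⟨i, rfl⟩ := hnew u hu huS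
      simpa only [if_neg huS] using (hfix i).trans Set.subset_union_right

end PingPong

section Flags

variable {n : ℕ}

/-- The coordinatewise cast of a rational vector to a real one. -/
def ratVec : (Fin n → ℚ) →ₗ[ℚ] (Fin n → ℝ) where
  toFun v i := (v i : ℝ)
  map_add' v w := by ext i; simp
  map_smul' c v := by ext i; simp [Rat.smul_def]

lemma ratVec_apply (v : Fin n → ℚ) (i : Fin n) : ratVec v i = (v i : ℝ) := rfl

lemma ratVec_smul (c : ℚ) (v : Fin n → ℚ) : ratVec (c • v) = (c : ℝ) • ratVec v := by
  ext i; simp [ratVec_apply]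

lemma ratVec_castVec (v : Fin n → ℤ) : ratVec (castVec ℚ v) = castVec ℝ v := by
  ext i; simp [ratVec_apply, castVec]

lemma ratVec_dot (v w : Fin n → ℚ) : ratVec v ⬝ᵥ ratVec w = ((v ⬝ᵥ w : ℚ) : ℝ) := by
  simp [ratVec_apply, dotProduct]

lemma ratVec_ne_zero {v : Fin n → ℚ} (hv : v ≠ 0) : ratVec v ≠ 0 := fun h => hv (by
  ext i
  have := congrFun h i
  simpa [ratVec_apply] using this)

lemma castVec_int_multiple_ne_zero {v : Fin n → ℚ} (hv : v ≠ 0) {c : ℚ} (hc : c ≠ 0)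
    {w : Fin n → ℤ} (hw : castVec ℚ w = c • v) : w ≠ 0 := by
  rintro rfl
  exact smul_ne_zero hc hv (hw.symm.trans (by ext; simp [castVec]))

lemma RatPoint.exists_castVec {p : Proj n} (hp : RatPoint p) : ∃ (v : Fin n → ℤ) (hv : v ≠ 0),
    p = Projectivization.mk ℝ (castVec ℝ v) (castVec_ne_zero hv) := by
  obtain ⟨q, hq⟩ := hp
  change p.submodule = Submodule.span ℝ {ratVec q} at hq
  have hq0 : q ≠ 0 := by
    rintro rfl
    have h1 := p.finrank_submodule
    rw [hq, map_zero, Submodule.span_zero_singleton, finrank_bot] at h1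
    exact zero_ne_one h1
  obtain ⟨c, hc, v, hv⟩ := exists_int_multiple q
  have hv0 := castVec_int_multiple_ne_zero hq0 hc hv
  refine ⟨v, hv0, ?_⟩
  apply Projectivization.submodule_injective
  rw [hq, Projectivization.submodule_mk, ← ratVec_castVec, hv, ratVec_smul,
    Submodule.span_singleton_smul_eq (IsUnit.mk0 _ (by exact_mod_cast hc))]

lemma IsRatSubmodule.exists_perp {W : Submodule ℝ (Fin n → ℝ)} (hW : IsRatSubmodule W)
    (hn : 1 ≤ n) (hr : Module.finrank ℝ W = n - 1) :
    ∃ φ : Fin n → ℤ, φ ≠ 0 ∧ W = perp (castVec ℝ φ) := by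
  obtain ⟨T, hT⟩ := hW
  change W = Submodule.span ℝ (ratVec '' T) at hT
  have htop : Submodule.span ℚ T ≠ ⊤ := by
    intro h
    have hle : Submodule.span ℚ T ≤ (W.restrictScalars ℚ).comap ratVec :=
      Submodule.span_le.2 fun v hv => by
        change ratVec v ∈ W
        rw [hT]
        exact Submodule.subset_span ⟨v, hv, rfl⟩
    have hWtop : W = ⊤ := by
      rw [eq_top_iff]
      intro v _
      rw [pi_eq_sum_univ' v]
      refine Submodule.sum_mem _ fun i _ => Submodule.smul_mem _ _ ?_
      have : ratVec (Pi.single i 1) ∈ W := hle (h ▸ Submodule.mem_top)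
      convert this using 1
      ext j
      by_cases hij : j = i
      · subst hij; simp [ratVec_apply]
      · simp [ratVec_apply, hij]
    rw [hWtop, finrank_top, Module.finrank_fin_fun] at hr
    omega
  obtain ⟨x, hx, hxT⟩ := exists_dot_eq_zero htop
  obtain ⟨c, hc, φ, hφ⟩ := exists_int_multiple x
  have hφ0 := castVec_int_multiple_ne_zero hx hc hφ
  refine ⟨φ, hφ0, Submodule.eq_of_le_of_finrank_le ?_ ?_⟩
  · rw [hT, Submodule.span_le]
    rintro _ ⟨v, hv, rfl⟩
    change _ ⬝ᵥ _ = _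
    rw [← ratVec_castVec, ratVec_dot, hφ, smul_dotProduct, hxT v (Submodule.subset_span hv),
      smul_zero, Rat.cast_zero]
  · have hlt : perp (castVec ℝ φ) < ⊤ := by
      rw [lt_top_iff_ne_top]
      intro h
      exact dot_self_ne_zero (castVec_ne_zero hφ0)
        (mem_perp.1 (h ▸ Submodule.mem_top (x := castVec ℝ φ)))
    have := Submodule.finrank_lt hlt.ne
    rw [Module.finrank_fin_fun] at this
    omega

/-- A rational flag can be perturbed to a family of mutually transverse rational flags. -/
lemma IsCompatMetric.exists_transverse_flags {d : Proj n → Proj n → ℝ} (hd : IsCompatMetric d)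
    {v φ : Fin n → ℤ} (hv : v ≠ 0) (hφ : φ ≠ 0) (h0 : φ ⬝ᵥ v = 0) (T : Type*) [Countable T]
    {ε δ : ℝ} (hε : 0 < ε) (hδ : 0 < δ) :
    ∃ (y ψ : Option T → Fin n → ℚ) (hy : ∀ i, ratVec (y i) ≠ 0),
      y none = castVec ℚ v ∧ ψ none = castVec ℚ φ ∧ (∀ i, ψ i ≠ 0) ∧ (∀ i, ψ i ⬝ᵥ y i = 0) ∧
      (∀ i j, i ≠ j → ψ j ⬝ᵥ y i ≠ 0) ∧
      (∀ i, d (Projectivization.mk ℝ (castVec ℝ v) (castVec_ne_zero hv))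
        (Projectivization.mk ℝ (ratVec (y i)) (hy i)) < ε) ∧
      ∀ i, ∀ z ∈ projSet (perp (ratVec (ψ i))),
        ∃ w ∈ projSet (perp (castVec ℝ φ)), d z w < δ := by
  obtain ⟨κ₁, hκ₁, h₁⟩ := hd.exists_near (castVec_ne_zero (R := ℝ) hv) hε
  obtain ⟨κ₂, hκ₂, h₂⟩ := hd.exists_perp_near (castVec_ne_zero (R := ℝ) hφ) hδ
  set V : ℚ := castVec ℚ v ⬝ᵥ castVec ℚ v with hV
  set F : ℚ := castVec ℚ φ ⬝ᵥ castVec ℚ φ with hF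
  have hV0 : V ≠ 0 := dot_self_ne_zero (castVec_ne_zero hv)
  have hF0 : F ≠ 0 := dot_self_ne_zero (castVec_ne_zero hφ)
  have hφv : castVec ℚ φ ⬝ᵥ castVec ℚ v = 0 := by rw [castVec_dot, h0, Int.cast_zero]
  have hvφ : castVec ℚ v ⬝ᵥ castVec ℚ φ = 0 := by rw [dotProduct_comm, hφv]
  set C₁ : ℝ := |(V : ℝ)| * ‖castVec ℝ φ‖ with hC₁
  set C₂ : ℝ := |(F : ℝ)| * ‖castVec ℝ v‖ with hC₂
  have hC₁0 : 0 ≤ C₁ := by positivity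
  have hC₂0 : 0 ≤ C₂ := by positivity
  obtain ⟨τ, hτ0, hτ⟩ := exists_rat_btwn (show (0 : ℝ) < min (κ₁ / (C₁ + 1)) (κ₂ / (C₂ + 1)) by
    positivity)
  have hτ0' : 0 < τ := by exact_mod_cast hτ0
  have hτ₁ : τ * C₁ < κ₁ := by
    have := (lt_div_iff₀ (by positivity)).1 (hτ.trans_le (min_le_left _ _))
    nlinarith
  have hτ₂ : τ * C₂ < κ₂ := by
    have := (lt_div_iff₀ (by positivity)).1 (hτ.trans_le (min_le_right _ _))
    nlinarith
  obtain ⟨f, hf⟩ := exists_injective_nat T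
  obtain ⟨t, ht0, htinj, htle⟩ : ∃ t : Option T → ℚ, t none = 0 ∧ Function.Injective t ∧
      ∀ i, |t i| ≤ τ := by
    refine ⟨fun i => i.elim 0 fun s => τ / (f s + 1), rfl, ?_, ?_⟩
    · have hpos : ∀ s, τ / ((f s : ℚ) + 1) ≠ 0 := fun s => by positivity
      rintro (_ | s) (_ | s') h
      · rfl
      · exact absurd h.symm (hpos s')
      · exact absurd h (hpos s)
      · congr 1
        apply hf
        have h' : τ / ((f s : ℚ) + 1) = τ / ((f s' : ℚ) + 1) := h
        rw [div_eq_div_iff (by positivity) (by positivity)] at h'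
        have h2 := mul_left_cancel₀ hτ0'.ne' h'
        exact_mod_cast (add_right_cancel h2).symm
    · rintro (_ | s)
      · simpa using hτ0'.le
      · change |τ / ((f s : ℚ) + 1)| ≤ τ
        rw [abs_of_pos (by positivity)]
        exact div_le_self hτ0'.le (by simp)
  have htle' : ∀ i, |((t i : ℚ) : ℝ)| ≤ τ := fun i => by exact_mod_cast htle i
  set y : Option T → Fin n → ℚ := fun i => castVec ℚ v + (t i * V) • castVec ℚ φ with hy
  set ψ : Option T → Fin n → ℚ := fun i => castVec ℚ φ - (t i * F) • castVec ℚ v with hψ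
  have hdot : ∀ i j, ψ j ⬝ᵥ y i = (t i - t j) * (V * F) := by
    intro i j
    simp only [hy, hψ, sub_dotProduct, dotProduct_add, smul_dotProduct, dotProduct_smul, hφv, hvφ,
      ← hV, ← hF, smul_eq_mul]
    ring
  have hy0 : ∀ i, y i ≠ 0 := fun i h => hV0 (by
    have : castVec ℚ v ⬝ᵥ y i = V := by
      simp only [hy, dotProduct_add, dotProduct_smul, hvφ, ← hV, smul_eq_mul, mul_zero, add_zero]
    rw [← this, h, dotProduct_zero])
  have hψ0 : ∀ i, ψ i ≠ 0 := fun i h => hF0 (by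
    have : castVec ℚ φ ⬝ᵥ ψ i = F := by
      simp only [hψ, dotProduct_sub, dotProduct_smul, hφv, ← hF, smul_eq_mul, mul_zero, sub_zero]
    rw [← this, h, dotProduct_zero])
  refine ⟨y, ψ, fun i => ratVec_ne_zero (hy0 i), ?_, ?_, hψ0, ?_, ?_, ?_, ?_⟩
  · simp only [hy, ht0, zero_mul, zero_smul, add_zero]
  · simp only [hψ, ht0, zero_mul, zero_smul, sub_zero]
  · intro i
    rw [hdot, sub_self, zero_mul]
  · intro i j hij
    rw [hdot]
    exact mul_ne_zero (sub_ne_zero.2 (htinj.ne hij)) (mul_ne_zero hV0 hF0)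
  · intro i
    refine (h₁ (ratVec (y i)) ?_).2
    have e : ratVec (y i) - castVec ℝ v = ((t i * V : ℚ) : ℝ) • castVec ℝ φ := by
      simp only [hy, map_add, ratVec_smul, ratVec_castVec, add_sub_cancel_left]
    rw [e, norm_smul, Real.norm_eq_abs, Rat.cast_mul, abs_mul, mul_assoc, ← hC₁]
    exact lt_of_le_of_lt (mul_le_mul_of_nonneg_right (htle' i) hC₁0) hτ₁
  · intro i
    refine h₂ (ratVec (ψ i)) ?_
    have e : ratVec (ψ i) - castVec ℝ φ = -(((t i * F : ℚ) : ℝ) • castVec ℝ v) := by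
      simp only [hψ, map_sub, ratVec_smul, ratVec_castVec, sub_sub_cancel_left]
    rw [e, norm_neg, norm_smul, Real.norm_eq_abs, Rat.cast_mul, abs_mul, mul_assoc, ← hC₂]
    exact lt_of_le_of_lt (mul_le_mul_of_nonneg_right (htle' i) hC₂0) hτ₂

end Flags

section Throwing

variable {n : ℕ}

lemma exists_ne_zero_of_additive {V M : Type*} [Add V] [AddMonoid M] {f g : V → M} {a b : V}
    (hf : f (a + b) = f a + f b) (hg : g (a + b) = g a + g b) (ha : f a ≠ 0) (hb : g b ≠ 0) :
    ∃ v, (v = a ∨ v = b ∨ v = a + b) ∧ f v ≠ 0 ∧ g v ≠ 0 := by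
  by_cases h1 : g a = 0
  · by_cases h2 : f b = 0
    · exact ⟨a + b, by simp, by rwa [hf, h2, add_zero], by rwa [hg, h1, zero_add]⟩
    · exact ⟨b, by simp, h2, hb⟩
  · exact ⟨a, by simp, ha, h1⟩

lemma exists_int_add_mul_ne_zero {a b c e : ℚ} (hb : b ≠ 0) (he : e ≠ 0) :
    ∃ k : ℤ, a + k * b ≠ 0 ∧ c + k * e ≠ 0 := by
  have hsub : ∀ {p q : ℚ}, q ≠ 0 → {k : ℤ | p + k * q = 0}.Subsingleton := by
    intro p q hq k hk l hl
    have h1 : p + k * q = 0 := hk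
    have h2 : p + l * q = 0 := hl
    have h3 : (k : ℚ) * q = l * q := by linarith
    exact_mod_cast mul_right_cancel₀ hq h3
  obtain ⟨k, hk⟩ := ((hsub (p := a) hb).finite.union (hsub (p := c) he).finite).exists_notMem
  exact ⟨k, fun h => hk (Or.inl h), fun h => hk (Or.inr h)⟩

lemma castVec_zpow_mulVec {u : SLZ n} {y ψ : Fin n → ℚ} {M : ℚ} (h0 : ψ ⬝ᵥ y = 0)
    (hu : castMat ℚ u = 1 + M • vecMulVec y ψ) (k : ℤ) (x : Fin n → ℤ) :
    castVec ℚ ((u ^ k).1 *ᵥ x) = castVec ℚ x + (k * (M * (ψ ⬝ᵥ castVec ℚ x))) • y := by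
  rw [← castMat_mulVec, castMat_zpow h0 hu, add_mulVec, one_mulVec, smul_mulVec,
    vecMulVec_mulVec, op_smul_eq_smul, smul_smul, mul_assoc]

lemma castVec_vecMul_zpow_inv {u : SLZ n} {y ψ : Fin n → ℚ} {M : ℚ} (h0 : ψ ⬝ᵥ y = 0)
    (hu : castMat ℚ u = 1 + M • vecMulVec y ψ) (k : ℤ) (φ : Fin n → ℤ) :
    castVec ℚ (φ ᵥ* ((u ^ k)⁻¹).1) =
      castVec ℚ φ + (k * (-M * (castVec ℚ φ ⬝ᵥ y))) • ψ := by
  rw [← castVec_vecMul, ← _root_.zpow_neg, castMat_zpow h0 hu, vecMul_add, vecMul_one, vecMul_smul,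
    vecMul_vecMulVec, smul_smul]
  congr 2
  push_cast
  ring

/-- A transvection can be moved by a group with all transvections admissible into general position
with respect to a flag. -/
lemma IsTv.exists_conj_generic {H : Subgroup (SLZ n)}
    (hH : ∀ y ψ : Fin n → ℚ, ψ ⬝ᵥ y = 0 → Adm H y ψ) {τ : SLZ n} {x φ : Fin n → ℤ}
    (hτ : IsTv τ x φ) (hx : x ≠ 0) (hφ : φ ≠ 0) {y ψ : Fin n → ℚ} (hy : y ≠ 0) (hψ : ψ ≠ 0)
    (h0 : ψ ⬝ᵥ y = 0) : ∃ h ∈ H, ∃ x' φ' : Fin n → ℤ, IsTv (h * τ * h⁻¹) x' φ' ∧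
      ψ ⬝ᵥ castVec ℚ x' ≠ 0 ∧ castVec ℚ φ' ⬝ᵥ y ≠ 0 := by
  have hxx := dot_self_ne_zero (castVec_ne_zero (R := ℚ) hx)
  have hφφ := dot_self_ne_zero (castVec_ne_zero (R := ℚ) hφ)
  have hφx : castVec ℚ φ ⬝ᵥ castVec ℚ x = 0 := by rw [castVec_dot, hτ.1, Int.cast_zero]
  obtain ⟨q, -, hq1, hq2⟩ := exists_ne_zero_of_additive (f := fun v => castVec ℚ φ ⬝ᵥ v)
    (g := fun v => ψ ⬝ᵥ v) (dotProduct_add _ _ _) (dotProduct_add _ _ _) hφφ (dot_self_ne_zero hψ)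
  set α := (castVec ℚ φ ⬝ᵥ q) • castVec ℚ x - (castVec ℚ x ⬝ᵥ q) • castVec ℚ φ with hα
  set β := (ψ ⬝ᵥ q) • y - (y ⬝ᵥ q) • ψ with hβ
  have hαq : α ⬝ᵥ q = 0 := by
    rw [hα, sub_dotProduct, smul_dotProduct, smul_dotProduct, smul_eq_mul, smul_eq_mul]; ring
  have hβq : β ⬝ᵥ q = 0 := by
    rw [hβ, sub_dotProduct, smul_dotProduct, smul_dotProduct, smul_eq_mul, smul_eq_mul]; ring
  have hαx : α ⬝ᵥ castVec ℚ x ≠ 0 := by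
    rw [hα, sub_dotProduct, smul_dotProduct, smul_dotProduct, hφx, smul_zero, sub_zero]
    exact mul_ne_zero hq1 hxx
  have hβy : β ⬝ᵥ y ≠ 0 := by
    rw [hβ, sub_dotProduct, smul_dotProduct, smul_dotProduct, h0, smul_zero, sub_zero]
    exact mul_ne_zero hq2 (dot_self_ne_zero hy)
  obtain ⟨γ, hγ, hγx, hγy⟩ := exists_ne_zero_of_additive (f := fun v => v ⬝ᵥ castVec ℚ x)
    (g := fun v => v ⬝ᵥ y) (add_dotProduct _ _ _) (add_dotProduct _ _ _) hαx hβy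
  have hγq : γ ⬝ᵥ q = 0 := by
    rcases hγ with rfl | rfl | rfl
    · exact hαq
    · exact hβq
    · rw [add_dotProduct, hαq, hβq, add_zero]
  obtain ⟨-, M, hM, z, hz, hzM⟩ := hH q γ hγq
  obtain ⟨k, hk1, hk2⟩ := exists_int_add_mul_ne_zero (a := ψ ⬝ᵥ castVec ℚ x)
    (c := castVec ℚ φ ⬝ᵥ y) (mul_ne_zero (mul_ne_zero hM hγx) hq2)
    (mul_ne_zero (mul_ne_zero (neg_ne_zero.2 hM) hq1) hγy)
  refine ⟨z ^ k, zpow_mem hz k, _, _, hτ.conj (z ^ k), ?_, ?_⟩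
  · rw [castVec_zpow_mulVec hγq hzM, dotProduct_add, dotProduct_smul, smul_eq_mul, mul_assoc]
    exact hk1
  · rw [castVec_vecMul_zpow_inv hγq hzM, add_dotProduct, smul_dotProduct, smul_eq_mul, mul_assoc]
    exact hk2

/-- A transvection can be moved by a group with all transvections admissible arbitrarily close to
a given rational flag. -/
lemma IsTv.exists_conj_near {H : Subgroup (SLZ n)}
    (hH : ∀ y ψ : Fin n → ℚ, ψ ⬝ᵥ y = 0 → Adm H y ψ) {τ : SLZ n} {x φ : Fin n → ℤ}
    (hτ : IsTv τ x φ) (hx : x ≠ 0) (hφ : φ ≠ 0) {y ψ : Fin n → ℚ} (hy : y ≠ 0) (hψ : ψ ≠ 0)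
    (h0 : ψ ⬝ᵥ y = 0) {κ : ℝ} (hκ : 0 < κ) : ∃ h ∈ H, ∃ (x' φ' : Fin n → ℤ) (a b : ℝ),
      IsTv (h * τ * h⁻¹) x' φ' ∧ a ≠ 0 ∧ b ≠ 0 ∧ ‖a⁻¹ • castVec ℝ x' - ratVec y‖ < κ ∧
      ‖b⁻¹ • castVec ℝ φ' - ratVec ψ‖ < κ ∧ κ⁻¹ < |a * b| := by
  obtain ⟨h, hh, x₁, φ₁, hτ₁, hx₁, hφ₁⟩ := hτ.exists_conj_generic hH hx hφ hy hψ h0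
  obtain ⟨-, M, hM, z, hz, hzM⟩ := hH y ψ h0
  set A : ℚ := M * (ψ ⬝ᵥ castVec ℚ x₁) with hA
  set B : ℚ := -M * (castVec ℚ φ₁ ⬝ᵥ y) with hB
  have hA0 : (A : ℝ) ≠ 0 := by exact_mod_cast mul_ne_zero hM hx₁
  have hB0 : (B : ℝ) ≠ 0 := by exact_mod_cast mul_ne_zero (neg_ne_zero.2 hM) hφ₁
  clear_value A B
  set C : ℝ := min |(A : ℝ)| |(B : ℝ)| with hC
  have hC0 : 0 < C := lt_min (abs_pos.2 hA0) (abs_pos.2 hB0)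
  set D : ℝ := 1 + κ⁻¹ * (1 + ‖castVec ℝ x₁‖ + ‖castVec ℝ φ₁‖) with hD
  have hD0 : 0 < D := by positivity
  obtain ⟨k, hk⟩ := exists_nat_gt (D / C)
  rw [div_lt_iff₀ hC0] at hk
  have hk0 : (0 : ℝ) < k := by
    by_contra hcon
    nlinarith
  have hkA : D < |(k : ℝ) * A| := by
    rw [abs_mul, abs_of_pos hk0]
    exact hk.trans_le (mul_le_mul_of_nonneg_left (min_le_left _ _) hk0.le)
  have hkB : D < |(k : ℝ) * B| := by
    rw [abs_mul, abs_of_pos hk0]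
    exact hk.trans_le (mul_le_mul_of_nonneg_left (min_le_right _ _) hk0.le)
  have hsmall : ∀ {a : ℝ} {v : Fin n → ℝ}, D < |a| → κ⁻¹ * ‖v‖ ≤ D → ‖a⁻¹ • v‖ < κ := by
    intro a v ha hv
    have hpos : 0 < |a| := hD0.trans ha
    rw [norm_smul, norm_inv, Real.norm_eq_abs, inv_mul_lt_iff₀ hpos, mul_comm,
      ← inv_mul_lt_iff₀ hκ]
    exact hv.trans_lt ha
  have hκi : 0 < κ⁻¹ := inv_pos.2 hκ
  refine ⟨z ^ (k : ℤ) * h, mul_mem (zpow_mem hz _) hh, (z ^ (k : ℤ)).1 *ᵥ x₁,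
    φ₁ ᵥ* ((z ^ (k : ℤ))⁻¹).1, k * A, k * B, ?_,
    mul_ne_zero hk0.ne' hA0, mul_ne_zero hk0.ne' hB0, ?_, ?_, ?_⟩
  · have e : z ^ (k : ℤ) * h * τ * (z ^ (k : ℤ) * h)⁻¹ =
        z ^ (k : ℤ) * (h * τ * h⁻¹) * (z ^ (k : ℤ))⁻¹ := by group
    rw [e]
    exact hτ₁.conj (z ^ (k : ℤ))
  · have e : (k * A : ℝ)⁻¹ • castVec ℝ ((z ^ (k : ℤ)).1 *ᵥ x₁) - ratVec y =
        (k * A : ℝ)⁻¹ • castVec ℝ x₁ := by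
      rw [← ratVec_castVec, castVec_zpow_mulVec h0 hzM, map_add, ratVec_smul, ratVec_castVec,
        ← hA, smul_add, smul_smul, Rat.cast_mul, Rat.cast_intCast, Int.cast_natCast,
        inv_mul_cancel₀ (mul_ne_zero hk0.ne' hA0), one_smul, add_sub_cancel_right]
    rw [e]
    refine hsmall hkA ?_
    have : 0 ≤ κ⁻¹ * (1 + ‖castVec ℝ φ₁‖) := by positivity
    rw [hD]
    linarith
  · have e : (k * B : ℝ)⁻¹ • castVec ℝ (φ₁ ᵥ* ((z ^ (k : ℤ))⁻¹).1) - ratVec ψ =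
        (k * B : ℝ)⁻¹ • castVec ℝ φ₁ := by
      rw [← ratVec_castVec, castVec_vecMul_zpow_inv h0 hzM, map_add, ratVec_smul, ratVec_castVec,
        ← hB, smul_add, smul_smul, Rat.cast_mul, Rat.cast_intCast, Int.cast_natCast,
        inv_mul_cancel₀ (mul_ne_zero hk0.ne' hB0), one_smul, add_sub_cancel_right]
    rw [e]
    refine hsmall hkB ?_
    have : 0 ≤ κ⁻¹ * (1 + ‖castVec ℝ x₁‖) := by positivity
    rw [hD]
    linarith
  · have h1 : 1 ≤ D := by rw [hD]; exact le_add_of_nonneg_right (by positivity)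
    have h2 : κ⁻¹ ≤ D := by
      have : 0 ≤ κ⁻¹ * (‖castVec ℝ x₁‖ + ‖castVec ℝ φ₁‖) := by positivity
      rw [hD]
      linarith
    rw [abs_mul]
    calc κ⁻¹ ≤ D := h2
      _ < |(k : ℝ) * A| := hkA
      _ ≤ |(k : ℝ) * A| * |(k : ℝ) * B| :=
        le_mul_of_one_le_right (abs_nonneg _) (h1.trans hkB.le)

end Throwing

section Assembly

variable {n : ℕ}

lemma actSub_perp_castVec (g : SLZ n) (φ : Fin n → ℤ) :
    actSub g (perp (castVec ℝ φ)) = perp (castVec ℝ (φ ᵥ* (g⁻¹).1)) := by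
  have key : ∀ v, (castVec ℝ (φ ᵥ* (g⁻¹).1)) ⬝ᵥ v = castVec ℝ φ ⬝ᵥ (castMat ℝ g⁻¹ *ᵥ v) := by
    intro v
    rw [← castVec_vecMul, dotProduct_mulVec]
  ext w
  rw [mem_perp, key, actSub, Submodule.mem_map]
  constructor
  · rintro ⟨v, hv, rfl⟩
    rw [mulVecLin_apply, matR_eq_castMat, mulVec_mulVec, castMat_inv_mul, one_mulVec]
    exact hv
  · intro hw
    refine ⟨castMat ℝ g⁻¹ *ᵥ w, hw, ?_⟩
    rw [mulVecLin_apply, matR_eq_castMat, mulVec_mulVec, castMat_mul_inv, one_mulVec]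

lemma act_mk_castVec (g : SLZ n) {v : Fin n → ℤ} (hv : v ≠ 0) (hgv : g.1 *ᵥ v ≠ 0) :
    act g (Projectivization.mk ℝ (castVec ℝ v) (castVec_ne_zero hv)) =
      Projectivization.mk ℝ (castVec ℝ (g.1 *ᵥ v)) (castVec_ne_zero hgv) := by
  change Projectivization.mk ℝ (castMat ℝ g *ᵥ castVec ℝ v) _ = _
  simp only [castMat_mulVec]

lemma mulVec_ne_zero_of_ne_zero (g : SLZ n) {v : Fin n → ℤ} (hv : v ≠ 0) : g.1 *ᵥ v ≠ 0 := by
  intro h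
  apply hv
  have e := castMat_inv_mul ℤ g
  rw [castMat_int, castMat_int] at e
  rw [← one_mulVec v, ← e, ← mulVec_mulVec, h, mulVec_zero]

lemma vecMul_inv_ne_zero (g : SLZ n) {φ : Fin n → ℤ} (hφ : φ ≠ 0) : φ ᵥ* (g⁻¹).1 ≠ 0 := by
  intro h
  apply hφ
  have e := castMat_inv_mul ℤ g
  rw [castMat_int, castMat_int] at e
  rw [← vecMul_one φ, ← e, ← vecMul_vecMul, h, zero_vecMul]

lemma independent_of_perp_ne {φ ψ : Fin n → ℤ} (hφ : φ ≠ 0) (hψ : ψ ≠ 0)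
    (h : perp (castVec ℝ φ) ≠ perp (castVec ℝ ψ)) (r s : ℤ) (hrs : r • φ = s • ψ) :
    r = 0 ∧ s = 0 := by
  by_cases hr : r = 0
  · subst hr
    rw [zero_smul] at hrs
    exact ⟨rfl, (smul_eq_zero.1 hrs.symm).resolve_right hψ⟩
  by_cases hs : s = 0
  · subst hs
    rw [zero_smul] at hrs
    exact absurd ((smul_eq_zero.1 hrs).resolve_right hφ) hr
  refine absurd ?_ h
  ext w
  have e : (r : ℝ) * (castVec ℝ φ ⬝ᵥ w) = s * (castVec ℝ ψ ⬝ᵥ w) := by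
    rw [← smul_eq_mul, ← smul_eq_mul, ← smul_dotProduct, ← smul_dotProduct, ← castVec_smul,
      ← castVec_smul, hrs]
  have hr' : (r : ℝ) ≠ 0 := by exact_mod_cast hr
  have hs' : (s : ℝ) ≠ 0 := by exact_mod_cast hs
  rw [mem_perp, mem_perp]
  constructor <;> intro h0
  · rw [h0, mul_zero] at e
    exact (mul_eq_zero.1 e.symm).resolve_left hs'
  · rw [h0, mul_zero] at e
    exact (mul_eq_zero.1 e).resolve_left hr'

/-- A uniform lower bound for the distances between the points and the hyperplanes of distinct
flags in a finite transverse family. -/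
lemma IsCompatMetric.exists_uniform_gap {d : Proj n → Proj n → ℝ} (hd : IsCompatMetric d)
    {ι : Type*} [Finite ι] {y ψ : ι → Fin n → ℝ} (hy : ∀ i, y i ≠ 0)
    (h : ∀ i j, i ≠ j → ψ j ⬝ᵥ y i ≠ 0) {c : ℝ} (hc : 0 < c) :
    ∃ η > 0, η ≤ c ∧ ∀ i j, i ≠ j → ∀ w ∈ projSet (perp (ψ j)),
      η ≤ d (Projectivization.mk ℝ (y i) (hy i)) w := by
  have hev : ∀ᶠ η in nhdsWithin (0 : ℝ) (Set.Ioi 0), ∀ i j, i ≠ j →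
      ∀ w ∈ projSet (perp (ψ j)), η ≤ d (Projectivization.mk ℝ (y i) (hy i)) w := by
    rw [Filter.eventually_all]
    intro i
    rw [Filter.eventually_all]
    intro j
    by_cases hij : i = j
    · exact Filter.Eventually.of_forall fun _ h => absurd hij h
    · obtain ⟨η, hη, hb⟩ := hd.exists_far_perp (hy i) (h i j hij)
      filter_upwards [Ioc_mem_nhdsGT hη] with ξ hξ _ w hw
      exact hξ.2.trans (hb w hw)
  obtain ⟨η, h1, h2⟩ := (hev.and (Ioc_mem_nhdsGT hc)).exists
  exact ⟨η, h2.1, h2.2, h1⟩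

/-- Transvections along a large multiple of a fixed integral covector play near the flag. -/
lemma exists_isTv_playsNear {d : Proj n → Proj n → ℝ} (hd : IsCompatMetric d)
    {v φ : Fin n → ℤ} (hv : v ≠ 0) (hφ : φ ≠ 0) (h0 : φ ⬝ᵥ v = 0) {η : ℝ} (hη : 0 < η) :
    ∃ (m : ℤ) (u : SLZ n), m ≠ 0 ∧ IsTv u v (m • φ) ∧
      PlaysNear d η u (Projectivization.mk ℝ (castVec ℝ v) (castVec_ne_zero hv))
        (castVec ℝ φ) := by
  obtain ⟨κ, hκ, h⟩ := exists_playsNear hd (castVec_ne_zero (R := ℝ) hv)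
    (castVec_ne_zero (R := ℝ) hφ) hη
  obtain ⟨m, hm⟩ := exists_nat_gt κ⁻¹
  have hm0 : (0 : ℝ) < m := (inv_pos.2 hκ).trans hm
  obtain ⟨u, hu⟩ := exists_isTv (x := v) (φ := (m : ℤ) • φ) (by
    rw [smul_dotProduct, h0, smul_zero])
  have hmz : (m : ℤ) ≠ 0 := by
    have : m ≠ 0 := by rintro rfl; simp at hm0
    exact_mod_cast this
  refine ⟨m, u, hmz, hu, h u v _ 1 m hu one_ne_zero hm0.ne' ?_ ?_ ?_⟩
  · rwa [inv_one, one_smul, sub_self, norm_zero]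
  · rw [castVec_smul, Int.cast_natCast, smul_smul, inv_mul_cancel₀ hm0.ne', one_smul, sub_self,
      norm_zero]
    exact hκ
  · rwa [one_mul, abs_of_pos hm0]

end Assembly
/-- Lemma 2.12 (throwing): given a profinitely dense Schottky system `(S, 𝒜, ℛ)`,
`g ∈ SL(n,ℤ)`, rational flags `p₁ ∈ L₁`, `p₂ ∈ L₂` with the stated disjointness
conditions and `p₁ = g • p₂`, `L₁ ≠ g • L₂`, one can enlarge the Schottky system so
that together with `g` it generates all of `SL(n,ℤ)`. -/
theorem schottky_throwing (n : ℕ) (hn : 3 ≤ n) (g : SLZ n)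
    (d : Proj n → Proj n → ℝ) (hd : IsCompatMetric d)
    (S : Set (SLZ n)) (A R : Set (Proj n)) (hS : IsSchottky d S A R)
    (hpd : ProfinitelyDense (Subgroup.closure S))
    (ε δ : ℝ) (hε : 0 < ε) (hεδ : ε ≤ δ)
    (p₁ p₂ : Proj n) (hp₁ : RatPoint p₁) (hp₂ : RatPoint p₂)
    (W₁ W₂ : Submodule ℝ (Fin n → ℝ))
    (hW₁ : IsRatSubmodule W₁) (hW₂ : IsRatSubmodule W₂)
    (hW₁rank : Module.finrank ℝ W₁ = n - 1) (hW₂rank : Module.finrank ℝ W₂ = n - 1)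
    (hpW₁ : p₁.submodule ≤ W₁) (hpW₂ : p₂.submodule ≤ W₂)
    (h1a : (cThick d {p₁} ε ∪ cThick d {p₂} ε) ∩ R = ∅)
    (h1b : (cThick d (projSet W₁) δ ∪ cThick d (projSet W₂) δ) ∩ A = ∅)
    (h2a : cThick d {p₁} ε ∩ cThick d (projSet W₂) δ = ∅)
    (h2b : cThick d {p₂} ε ∩ cThick d (projSet W₁) δ = ∅)
    (h3a : p₁ = act g p₂) (h3b : W₁ ≠ actSub g W₂) :
    ∃ Splus : Set (SLZ n), S ⊆ Splus ∧
      IsSchottky d Splus (A ∪ cThick d {p₁} ε ∪ cThick d {p₂} ε)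
        (R ∪ cThick d (projSet W₁) δ ∪ cThick d (projSet W₂) δ) ∧
      Subgroup.closure (Splus ∪ {g}) = ⊤ := by
  obtain ⟨v₂, hv₂, rfl⟩ := hp₂.exists_castVec
  obtain ⟨φ₁, hφ₁, rfl⟩ := hW₁.exists_perp (by omega) hW₁rank
  obtain ⟨φ₂, hφ₂, rfl⟩ := hW₂.exists_perp (by omega) hW₂rank
  have hv₁ := mulVec_ne_zero_of_ne_zero g hv₂
  have hind := vecMul_inv_ne_zero g hφ₂
  rw [act_mk_castVec g hv₂ hv₁] at h3a
  subst h3a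
  rw [actSub_perp_castVec] at h3b
  replace hind := independent_of_perp_ne hφ₁ hind h3b
  generalize hv₁' : g.1 *ᵥ v₂ = v₁ at *
  have h01 : φ₁ ⬝ᵥ v₁ = 0 := by
    have := (mk_mem_projSet _).1 hpW₁
    rw [mem_perp, castVec_dot] at this
    exact_mod_cast this
  have h02 : φ₂ ⬝ᵥ v₂ = 0 := by
    have := (mk_mem_projSet _).1 hpW₂
    rw [mem_perp, castVec_dot] at this
    exact_mod_cast this
  have hδ : 0 < δ := hε.trans_le hεδ
  set P₁ := Projectivization.mk ℝ (castVec ℝ v₁) (castVec_ne_zero hv₁) with hP₁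
  set P₂ := Projectivization.mk ℝ (castVec ℝ v₂) (castVec_ne_zero hv₂) with hP₂
  obtain ⟨y, ψ, hy, hyv, hψφ, hψ0, hψy, htr, hyn, hψn⟩ := hd.exists_transverse_flags hv₁ hφ₁ h01
    {t : Fin n × Fin n // t.1 ≠ t.2} (half_pos hε) (half_pos hδ)
  obtain ⟨ζ, hζ, hζε, hgap⟩ := hd.exists_uniform_gap (y := fun i => ratVec (y i))
    (ψ := fun i => ratVec (ψ i)) hy
    (fun i j hij => by rw [ratVec_dot]; exact_mod_cast htr i j hij) (half_pos hε)
  obtain ⟨η, hη, hηζ⟩ : ∃ η > 0, 4 * η = ζ := ⟨ζ / 4, by positivity, by ring⟩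
  obtain ⟨m₁, u₁, hm₁, hu₁, hu₁n⟩ := exists_isTv_playsNear hd hv₁ hφ₁ h01 hη
  obtain ⟨m₂, u₂, hm₂, hu₂, hu₂n⟩ := exists_isTv_playsNear hd hv₂ hφ₂ h02 hη
  set H := Subgroup.closure (S ∪ {u₁, u₂, g}) with hH
  have hSH : Subgroup.closure S ≤ H := Subgroup.closure_mono Set.subset_union_left
  have hu₁H : u₁ ∈ H := Subgroup.subset_closure (by simp)
  have hu₂H : u₂ ∈ H := Subgroup.subset_closure (by simp)
  have hgH : g ∈ H := Subgroup.subset_closure (by simp)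
  have hadm : ∀ y ψ : Fin n → ℚ, ψ ⬝ᵥ y = 0 → Adm H y ψ := by
    have h₂ := (hu₂.conj g).adm (mul_mem (mul_mem hgH hu₂H) (inv_mem hgH))
    rw [hv₁', smul_vecMul] at h₂
    refine fun y ψ h => adm_of_independent hn hpd hSH hv₁ (hu₁.adm hu₁H) h₂ (fun r s hrs => ?_) h
    rw [smul_smul, smul_smul] at hrs
    obtain ⟨h1, h2⟩ := hind _ _ hrs
    exact ⟨(mul_eq_zero.1 h1).resolve_right hm₁, (mul_eq_zero.1 h2).resolve_right hm₂⟩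
  have hthrow : ∀ t : {t : Fin n × Fin n // t.1 ≠ t.2}, ∃ h ∈ H,
      PlaysNear d η (h * SpecialLinearGroup.transvection t.2 1 * h⁻¹)
        (Projectivization.mk ℝ (ratVec (y (some t))) (hy (some t))) (ratVec (ψ (some t))) := by
    intro t
    obtain ⟨κ, hκ, hp⟩ := exists_playsNear hd (hy (some t)) (ratVec_ne_zero (hψ0 (some t))) hη
    obtain ⟨h, hh, x', φ', a, b, h1, h2, h3, h4, h5, h6⟩ :=
      (isTv_transvection t.2).exists_conj_near hadm (by simp) (by simp)
        (fun h0 => hy (some t) (by rw [h0, map_zero])) (hψ0 (some t)) (hψy (some t)) hκ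
    exact ⟨h, hh, hp _ x' φ' a b h1 h2 h3 h4 h5 h6⟩
  choose h hhH hhn using hthrow
  have hP₁W : P₁ ∈ projSet (perp (castVec ℝ φ₁)) := hpW₁
  have hP₂W : P₂ ∈ projSet (perp (castVec ℝ φ₂)) := hpW₂
  have hfirst : ∀ i z, d z (Projectivization.mk ℝ (ratVec (y i)) (hy i)) < 2 * η →
      z ∈ cThick d {P₁} ε := fun i z hz => by
    refine (hd.setDist_le _ (Set.mem_singleton _)).trans ?_
    have h1 := hd.triangle z (Projectivization.mk ℝ (ratVec (y i)) (hy i)) P₁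
    have h2 := hyn i
    rw [hd.symm] at h2
    linarith
  have hfirst' : ∀ i z, ∀ x ∈ projSet (perp (ratVec (ψ i))), d z x < 2 * η →
      z ∈ cThick d (projSet (perp (castVec ℝ φ₁))) δ := fun i z x hx hz => by
    obtain ⟨w, hw, hxw⟩ := hψn i x hx
    refine (hd.setDist_le _ hw).trans ?_
    have h1 := hd.triangle z x w
    linarith
  have hsecond : ∀ z, d z P₂ < 2 * η → z ∈ cThick d {P₂} ε := fun z hz =>
    (hd.setDist_le _ (Set.mem_singleton _)).trans (by linarith)
  have hsecond' : ∀ z, ∀ x ∈ projSet (perp (castVec ℝ φ₂)), d z x < 2 * η →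
      z ∈ cThick d (projSet (perp (castVec ℝ φ₂))) δ := fun z x hx hz =>
    (hd.setDist_le _ hx).trans (by linarith)
  have hsub : ∀ {P : Proj n} {W : Submodule ℝ (Fin n → ℝ)}, P ∈ projSet W →
      cThick d {P} ε ⊆ cThick d (projSet W) δ := fun {P W} hP z hz => by
    have hz' : setDist d z {P} ≤ ε := hz
    rw [setDist, Set.image_singleton, csInf_singleton] at hz'
    exact (hd.setDist_le _ hP).trans (hz'.trans hεδ)
  let w : Option (Option {t : Fin n × Fin n // t.1 ≠ t.2}) → SLZ n
    | none => u₂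
    | some none => u₁
    | some (some t) => h t * SpecialLinearGroup.transvection t.2 1 * (h t)⁻¹
  let p : Option (Option {t : Fin n × Fin n // t.1 ≠ t.2}) → Proj n
    | none => P₂
    | some i => Projectivization.mk ℝ (ratVec (y i)) (hy i)
  let θ : Option (Option {t : Fin n × Fin n // t.1 ≠ t.2}) → Fin n → ℝ
    | none => castVec ℝ φ₂
    | some i => ratVec (ψ i)
  refine ⟨S ∪ Set.range w, Set.subset_union_left, ?_, ?_⟩
  · rw [Set.union_assoc, Set.union_assoc]
    refine hS.union_range (p := p) (ψ := θ)
      ((hd.isClosed_cThick (Set.singleton_nonempty _) _).union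
        (hd.isClosed_cThick (Set.singleton_nonempty _) _))
      ((hd.isClosed_cThick ⟨_, hP₁W⟩ _).union (hd.isClosed_cThick ⟨_, hP₂W⟩ _))
      (Set.union_subset_union (hsub hP₁W) (hsub hP₂W)) h1a h1b hη ?_ ?_ ?_ ?_
    · rintro (_ | _ | t)
      · exact hu₂n
      · simp only [w, p, θ, hyv, hψφ, ratVec_castVec]
        exact hu₁n
      · exact hhn t
    · rintro (_ | i) z hz
      · exact Or.inr (hsecond z hz)
      · exact Or.inl (hfirst i z hz)
    · rintro (_ | i) z x hx hz
      · exact Or.inr (hsecond' z x hx hz)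
      · exact Or.inl (hfirst' i z x hx hz)
    · rintro (_ | i) (_ | j) hij z x hx hz
      · exact absurd rfl hij
      · exact not_lt.1 fun hlt => (Set.ext_iff.1 h2b z).1 ⟨hsecond z hz, hfirst' j z x hx hlt⟩
      · exact not_lt.1 fun hlt => (Set.ext_iff.1 h2a z).1 ⟨hfirst i z hz, hsecond' z x hx hlt⟩
      · have h1 := hgap i j (fun e => hij (congrArg some e)) x hx
        have h2 := hd.triangle (Projectivization.mk ℝ (ratVec (y i)) (hy i)) z x
        have h3 : d z (Projectivization.mk ℝ (ratVec (y i)) (hy i)) < 2 * η := hz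
        rw [hd.symm] at h3
        linarith
  · have hw : ∀ i, w i ∈ Subgroup.closure (S ∪ Set.range w ∪ {g}) := fun i =>
      Subgroup.subset_closure (Or.inl (Or.inr ⟨i, rfl⟩))
    have hHle : H ≤ Subgroup.closure (S ∪ Set.range w ∪ {g}) := by
      rw [hH, Subgroup.closure_le]
      rintro x (hx | rfl | rfl | rfl)
      · exact Subgroup.subset_closure (Or.inl (Or.inl hx))
      · exact hw (some none)
      · exact hw none
      · exact Subgroup.subset_closure (Or.inr rfl)
    rw [eq_top_iff, ← elemSubgroup_eq_top, elemSubgroup, Subgroup.closure_le]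
    rintro _ ⟨i, j, hij, rfl⟩
    have h1 := hHle (hhH ⟨(i, j), hij⟩)
    have h2 := mul_mem (mul_mem (inv_mem h1) (hw (some (some ⟨(i, j), hij⟩)))) h1
    simpa [w, mul_assoc] using h2
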